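/- For any dimension d ≥ 1, any weight vector w ∈ (0,1)^d, and any τ > 1, the Hausdorff dimension of the set E_w(τ) of w-weighted τ-exactly-approximable vectors equals the Hausdorff dimension of the set W_w(τ) of w-weighted τ-approximable vectors: dim_H E_w(τ) = dim_H W_w(τ). -/

import Mathlib

open Real MeasureTheory Set

/-- The weighted norm `‖x‖_u = max_i |x_i|^(1/u_i)`. -/
noncomputable def wNorm {d : ℕ} (u : Fin d → ℝ) (x : Fin d → ℝ) : ℝ :=
  ⨆ i, |x i| ^ (1 / u i)

/-- The set `W_w(c,τ)` of `w`-weighted `(c,τ)`-approximable vectors in `[0,1)^d`. -/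
noncomputable def wApprox {d : ℕ} (w : Fin d → ℝ) (c τ : ℝ) : Set (Fin d → ℝ) :=
  {x | (∀ i, x i ∈ Set.Ico (0 : ℝ) 1) ∧
    {pq : (Fin d → ℤ) × ℕ | 0 < pq.2 ∧
      wNorm w (fun i => (pq.2 : ℝ) * x i - (pq.1 i : ℝ)) < c * (pq.2 : ℝ) ^ (-τ)}.Infinite}

/-- The set `E_w(τ)` of `w`-weighted `τ`-exactly-approximable vectors. -/
noncomputable def wExact {d : ℕ} (w : Fin d → ℝ) (τ : ℝ) : Set (Fin d → ℝ) :=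
  wApprox w 1 τ \ ⋃ c ∈ Set.Ioo (0 : ℝ) 1, wApprox w c τ


open Real MeasureTheory Set Filter Topology

theorem vol_line (a l h r : ℝ) (hr : 0 < r) (hl : 0 ≤ l) (hh : 0 ≤ h) :
    volume {x : ℝ | x ∈ Icc a (a + l) ∧ ∃ s : ℤ, |r * x - s| ≤ h} ≤
      ENNReal.ofReal ((r * l + 2 * h + 1) * (2 * h / r)) := by
  set J : Finset ℤ := Finset.Icc ⌈r * a - h⌉ ⌊r * (a + l) + h⌋ with hJ
  have hsub : {x : ℝ | x ∈ Icc a (a + l) ∧ ∃ s : ℤ, |r * x - s| ≤ h} ⊆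
      ⋃ s ∈ J, Icc (((s : ℝ) - h) / r) (((s : ℝ) + h) / r) := by
    rintro x ⟨⟨hx1, hx2⟩, s, hs⟩
    rw [abs_le] at hs
    have h1 : r * a ≤ r * x := by gcongr
    have h2 : r * x ≤ r * (a + l) := by gcongr
    simp only [mem_iUnion, mem_Icc]
    refine ⟨s, ?_, ?_, ?_⟩
    · rw [hJ, Finset.mem_Icc]
      constructor
      · apply Int.ceil_le.2; linarith
      · apply Int.le_floor.2; linarith
    · rw [div_le_iff₀ hr]; linarith
    · rw [le_div_iff₀ hr]; linarith
  have hcard : (J.card : ℝ) ≤ r * l + 2 * h + 1 := by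
    rw [hJ, Int.card_Icc]
    have h1 : (⌊r * (a + l) + h⌋ : ℝ) ≤ r * (a + l) + h := Int.floor_le _
    have h2 : (r * a - h : ℝ) ≤ ⌈r * a - h⌉ := Int.le_ceil _
    have h3 : 0 ≤ r * l := by positivity
    have : ((⌊r * (a + l) + h⌋ + 1 - ⌈r * a - h⌉).toNat : ℝ) =
        ((max (⌊r * (a + l) + h⌋ + 1 - ⌈r * a - h⌉) 0 : ℤ) : ℝ) := by
      rw [← Int.toNat_eq_max, Int.cast_natCast]
    rw [this]
    push_cast
    apply max_le
    · linarith
    · positivity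
  calc volume _ ≤ volume (⋃ s ∈ J, Icc (((s : ℝ) - h) / r) (((s : ℝ) + h) / r)) := measure_mono hsub
    _ ≤ ∑ s ∈ J, volume (Icc (((s : ℝ) - h) / r) (((s : ℝ) + h) / r)) := measure_biUnion_finset_le _ _
    _ = ∑ s ∈ J, ENNReal.ofReal (2 * h / r) := by
        apply Finset.sum_congr rfl
        intro s _
        rw [Real.volume_Icc]
        congr 1
        ring
    _ = ENNReal.ofReal (J.card * (2 * h / r)) := by
        rw [Finset.sum_const, nsmul_eq_mul, ENNReal.ofReal_mul (by positivity), ENNReal.ofReal_natCast]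
    _ ≤ _ := by
        apply ENNReal.ofReal_le_ofReal
        gcongr

theorem vol_res {d : ℕ} (a l h : Fin d → ℝ) (r : ℝ) (hr : 0 < r) (hl : ∀ i, 0 ≤ l i)
    (hh : ∀ i, 0 ≤ h i) :
    volume {x : Fin d → ℝ | (∀ i, x i ∈ Icc (a i) (a i + l i)) ∧
        ∃ s : Fin d → ℤ, ∀ i, |r * x i - s i| ≤ h i} ≤
      ENNReal.ofReal (∏ i, ((r * l i + 2 * h i + 1) * (2 * h i / r))) := by
  have : {x : Fin d → ℝ | (∀ i, x i ∈ Icc (a i) (a i + l i)) ∧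
        ∃ s : Fin d → ℤ, ∀ i, |r * x i - s i| ≤ h i} =
      Set.pi univ (fun i => {x : ℝ | x ∈ Icc (a i) (a i + l i) ∧ ∃ s : ℤ, |r * x - s| ≤ h i}) := by
    ext x
    simp only [Set.mem_ofPred_eq, Set.mem_pi, Set.mem_univ, forall_const]
    constructor
    · rintro ⟨h1, s, hs⟩ i
      exact ⟨h1 i, s i, hs i⟩
    · intro H
      choose H1 s hs using H
      exact ⟨H1, s, hs⟩
  rw [this, volume_pi_pi, ENNReal.ofReal_prod_of_nonneg]
  · apply Finset.prod_le_prod'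
    intro i _
    exact vol_line _ _ _ _ hr (hl i) (hh i)
  · intro i _
    have := hl i; have := hh i
    positivity

theorem vol_tail {d : ℕ} (a l e : Fin d → ℝ) (hl : ∀ i, 0 ≤ l i)
    (he : ∀ i, 0 < e i) (hsum : 1 < ∑ i, e i) (η : ℝ) (hη : 0 < η) :
    ∀ᶠ X : ℕ in atTop, volume {x : Fin d → ℝ | (∀ i, x i ∈ Icc (a i) (a i + l i)) ∧
        ∃ r : ℕ, X ≤ r ∧ ∃ s : Fin d → ℤ, ∀ i, |(r : ℝ) * x i - s i| ≤ 2 * (r : ℝ) ^ (-e i)} ≤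
      ENNReal.ofReal η := by
  set C : ℝ := ∏ i, ((l i + 5) * 4) with hC
  have hC0 : 0 ≤ C := Finset.prod_nonneg fun i _ => by have := hl i; positivity
  set f : ℕ → ℝ := fun r => C * (r : ℝ) ^ (-∑ i, e i) with hf
  have hfs : Summable f := by
    apply Summable.mul_left
    rw [Real.summable_nat_rpow]
    linarith
  have hf0 : ∀ r, 0 ≤ f r := fun r => by positivity
  have hlim := ENNReal.tendsto_sum_nat_add (fun r => ENNReal.ofReal (f r)) hfs.tsum_ofReal_ne_top
  have hev := (ENNReal.tendsto_nhds_zero.1 hlim) (ENNReal.ofReal η) (by simpa using hη)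
  filter_upwards [hev, eventually_ge_atTop 1] with X hX hX1
  refine le_trans ?_ hX
  have hsub : {x : Fin d → ℝ | (∀ i, x i ∈ Icc (a i) (a i + l i)) ∧
        ∃ r : ℕ, X ≤ r ∧ ∃ s : Fin d → ℤ, ∀ i, |(r : ℝ) * x i - s i| ≤ 2 * (r : ℝ) ^ (-e i)} ⊆
      ⋃ k : ℕ, {x : Fin d → ℝ | (∀ i, x i ∈ Icc (a i) (a i + l i)) ∧
        ∃ s : Fin d → ℤ, ∀ i, |((k + X : ℕ) : ℝ) * x i - s i| ≤ 2 * ((k + X : ℕ) : ℝ) ^ (-e i)} := by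
    rintro x ⟨h1, r, hr, s, hs⟩
    rw [mem_iUnion]
    refine ⟨r - X, h1, s, ?_⟩
    rw [Nat.sub_add_cancel hr]
    exact hs
  refine (measure_mono hsub).trans ((measure_iUnion_le _).trans ?_)
  apply ENNReal.tsum_le_tsum
  intro k
  have hr1 : (1 : ℝ) ≤ ((k + X : ℕ) : ℝ) := by exact_mod_cast (by omega : 1 ≤ k + X)
  set r : ℝ := ((k + X : ℕ) : ℝ)
  have hr0 : 0 < r := by linarith
  refine (vol_res a l (fun i => 2 * r ^ (-e i)) r hr0 hl (fun i => by positivity)).trans ?_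
  apply ENNReal.ofReal_le_ofReal
  have : f (k + X) = ∏ i, ((l i + 5) * 4 * r ^ (-e i)) := by
    rw [Finset.prod_mul_distrib, ← Real.rpow_sum_of_pos hr0, Finset.sum_neg_distrib]
  rw [this]
  apply Finset.prod_le_prod
  · intro i _
    have := hl i
    positivity
  · intro i _
    have hli := hl i
    have h1 : r ^ (-e i) ≤ 1 := by
      apply Real.rpow_le_one_of_one_le_of_nonpos hr1
      linarith [he i]
    have h2 : (r * l i + 2 * (2 * r ^ (-e i)) + 1) ≤ (l i + 5) * r := by nlinarith
    calc (r * l i + 2 * (2 * r ^ (-e i)) + 1) * (2 * (2 * r ^ (-e i)) / r)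
        ≤ ((l i + 5) * r) * (2 * (2 * r ^ (-e i)) / r) := by gcongr
      _ = _ := by field_simp; ring

theorem vol_short {d : ℕ} (a l v : Fin d → ℝ) (hl : ∀ i, 0 < l i)
    (hv : ∀ i, 0 < v i) (hsum : ∑ i, v i = 1) (A ρ : ℝ) (hA : 0 < A) (hρ : 0 < ρ)
    (hAρ : (4 * A) ^ d * ρ ≤ 1 / 16) :
    ∀ᶠ Q : ℕ in atTop, volume {x : Fin d → ℝ | (∀ i, x i ∈ Icc (a i) (a i + l i)) ∧
        ∃ r : ℕ, 1 ≤ r ∧ (r : ℝ) ≤ ρ * Q ∧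
          ∃ s : Fin d → ℤ, ∀ i, |(r : ℝ) * x i - s i| ≤ A * (Q : ℝ) ^ (-v i)} ≤
      ENNReal.ofReal ((∏ i, l i) / 8) := by
  set B : ℝ := 2 * A + 1 with hB
  obtain ⟨r0, hr0⟩ : ∃ r0 : ℕ, ∀ i, B ≤ l i * r0 := by
    have : ∀ i, ∃ r0 : ℕ, B / l i ≤ r0 := fun i => exists_nat_ge _
    choose g hg using this
    refine ⟨∑ i, g i, fun i => ?_⟩
    have h1 : g i ≤ ∑ i, g i := Finset.single_le_sum (fun _ _ => Nat.zero_le _) (Finset.mem_univ i)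
    have h2 : (g i : ℝ) ≤ ((∑ i, g i : ℕ) : ℝ) := by exact_mod_cast h1
    have h3 := (hg i).trans h2
    rw [div_le_iff₀ (hl i)] at h3
    linarith
  set Pl : ℝ := ∏ i, l i with hPl
  have hPl0 : 0 < Pl := Finset.prod_pos fun i _ => hl i
  set K : ℝ := ∏ i, (l i + B) with hK
  have hB0 : 0 < B := by positivity
  have hK0 : 0 < K := Finset.prod_pos fun i _ => by have := hl i; positivity
  have hQbig : ∀ᶠ Q : ℕ in atTop, (2 * A) ^ d * (r0 * K) * 16 / Pl ≤ (Q : ℝ) :=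
    tendsto_natCast_atTop_atTop.eventually_ge_atTop _
  filter_upwards [hQbig, eventually_ge_atTop 1] with Q hQ hQ1
  have hQ1' : (1 : ℝ) ≤ Q := by exact_mod_cast hQ1
  have hQ0 : (0 : ℝ) < Q := by linarith
  have hsub : {x : Fin d → ℝ | (∀ i, x i ∈ Icc (a i) (a i + l i)) ∧
        ∃ r : ℕ, 1 ≤ r ∧ (r : ℝ) ≤ ρ * Q ∧
          ∃ s : Fin d → ℤ, ∀ i, |(r : ℝ) * x i - s i| ≤ A * (Q : ℝ) ^ (-v i)} ⊆
      ⋃ r ∈ Finset.Icc 1 ⌊ρ * Q⌋₊, {x : Fin d → ℝ | (∀ i, x i ∈ Icc (a i) (a i + l i)) ∧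
          ∃ s : Fin d → ℤ, ∀ i, |(r : ℝ) * x i - s i| ≤ A * (Q : ℝ) ^ (-v i)} := by
    rintro x ⟨h1, r, hr, hr2, s, hs⟩
    simp only [mem_iUnion]
    exact ⟨r, Finset.mem_Icc.2 ⟨hr, Nat.le_floor hr2⟩, h1, s, hs⟩
  refine (measure_mono hsub).trans ((measure_biUnion_finset_le _ _).trans ?_)
  have hterm : ∀ r ∈ Finset.Icc 1 ⌊ρ * Q⌋₊, volume {x : Fin d → ℝ | (∀ i, x i ∈ Icc (a i) (a i + l i)) ∧
          ∃ s : Fin d → ℤ, ∀ i, |(r : ℝ) * x i - s i| ≤ A * (Q : ℝ) ^ (-v i)} ≤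
      ENNReal.ofReal ((2 * A) ^ d * (Q : ℝ)⁻¹ * (2 ^ d * Pl + if r < r0 then K else 0)) := by
    intro r hr
    rw [Finset.mem_Icc] at hr
    have hr1 : (1 : ℝ) ≤ r := by exact_mod_cast hr.1
    have hrp : (0 : ℝ) < r := by linarith
    refine (vol_res a l (fun i => A * (Q : ℝ) ^ (-v i)) r hrp (fun i => (hl i).le) (fun i => by positivity)).trans ?_
    apply ENNReal.ofReal_le_ofReal
    have e1 : (2 * A) ^ d * (Q : ℝ)⁻¹ = ∏ i, (2 * A * (Q : ℝ) ^ (-v i)) := by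
      rw [Finset.prod_mul_distrib, ← Real.rpow_sum_of_pos hQ0, Finset.sum_neg_distrib, hsum,
        Real.rpow_neg_one]
      simp
    have step1 : ∏ i, ((r * l i + 2 * (A * (Q : ℝ) ^ (-v i)) + 1) * (2 * (A * (Q : ℝ) ^ (-v i)) / r)) ≤
        ∏ i, ((2 * A * (Q : ℝ) ^ (-v i)) * (l i + B / r)) := by
      apply Finset.prod_le_prod
      · intro i _; have := hl i; positivity
      · intro i _
        have h1 : (Q : ℝ) ^ (-v i) ≤ 1 := by
          apply Real.rpow_le_one_of_one_le_of_nonpos hQ1'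
          linarith [hv i]
        have h2 : (r * l i + 2 * (A * (Q : ℝ) ^ (-v i)) + 1) ≤ r * l i + B := by
          rw [hB]; nlinarith
        calc _ ≤ (r * l i + B) * (2 * (A * (Q : ℝ) ^ (-v i)) / r) := by gcongr
          _ = _ := by field_simp
    refine step1.trans ?_
    rw [Finset.prod_mul_distrib, ← e1]
    gcongr
    split_ifs with hlt
    · have : ∏ i, (l i + B / r) ≤ K := by
        apply Finset.prod_le_prod
        · intro i _; have := hl i; positivity
        · intro i _
          gcongr
          exact div_le_self hB0.le hr1
      have : 0 ≤ 2 ^ d * Pl := by positivity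
      linarith
    · have h2 : (2 : ℝ) ^ d * Pl = ∏ i, (2 * l i) := by
        rw [Finset.prod_mul_distrib]; simp [hPl]
      rw [add_zero, h2]
      apply Finset.prod_le_prod
      · intro i _; have := hl i; positivity
      · intro i _
        have h3 : (r0 : ℝ) ≤ r := by exact_mod_cast not_lt.1 hlt
        have h4 : B / r ≤ l i := by
          rw [div_le_iff₀ hrp]
          exact (hr0 i).trans (by have := hl i; gcongr)
        linarith
  refine (Finset.sum_le_sum hterm).trans ?_
  rw [← ENNReal.ofReal_sum_of_nonneg (fun r _ => by split_ifs <;> positivity)]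
  apply ENNReal.ofReal_le_ofReal
  rw [← Finset.mul_sum, Finset.sum_add_distrib, Finset.sum_const, Nat.card_Icc, nsmul_eq_mul,
    ← Finset.sum_filter, Finset.sum_const, nsmul_eq_mul]
  have hc1 : ((⌊ρ * Q⌋₊ + 1 - 1 : ℕ) : ℝ) ≤ ρ * Q := by
    simpa using Nat.floor_le (by positivity : 0 ≤ ρ * (Q : ℝ))
  have hc2 : ((Finset.filter (fun r => r < r0) (Finset.Icc 1 ⌊ρ * Q⌋₊)).card : ℝ) ≤ r0 := by
    have : (Finset.filter (fun r => r < r0) (Finset.Icc 1 ⌊ρ * Q⌋₊)).card ≤ (Finset.range r0).card := by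
      apply Finset.card_le_card
      intro r hr
      simp only [Finset.mem_filter] at hr
      simpa using hr.2
    rw [Finset.card_range] at this
    exact_mod_cast this
  calc _ ≤ (2 * A) ^ d * (Q : ℝ)⁻¹ * (ρ * Q * (2 ^ d * Pl) + r0 * K) := by gcongr
    _ = ((4 * A) ^ d * ρ) * Pl + ((2 * A) ^ d * (r0 * K)) / Q := by
        have : (4 * A) ^ d = (2 * A) ^ d * 2 ^ d := by rw [← mul_pow]; ring
        rw [this]; field_simp
    _ ≤ (1 / 16) * Pl + Pl / 16 := by
        gcongr ?_ * _ + ?_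
        rw [div_le_div_iff₀ hQ0 (by norm_num)]
        rw [div_le_iff₀ hPl0] at hQ
        linarith
    _ = _ := by ring

open Real MeasureTheory Set Filter Topology

/-- Parameters of the construction. -/
structure Par (d : ℕ) where
  w : Fin d → ℝ
  v : Fin d → ℝ
  τ : ℝ
  b : ℝ
  δ : ℝ
  hd : 0 < d
  hw : ∀ i, 0 < w i
  hwsum : ∑ i, w i = 1
  hτ : 1 < τ
  hv : ∀ i, 0 < v i
  hvsum : ∑ i, v i = 1
  hb : 1 < b
  hvb : ∀ i, b ^ 2 * v i ≤ τ * w i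
  hδ : 0 < δ
  hδv : ∀ i, δ ≤ (b ^ 2 - b) * v i

theorem dirichlet_v {d : ℕ} (v : Fin d → ℝ) (hv : ∀ i, 0 < v i) (hsum : ∑ i, v i = 1)
    (x : Fin d → ℝ) (Q : ℕ) (hQ : 1 ≤ Q) :
    ∃ q : ℕ, 1 ≤ q ∧ q ≤ Q ∧ ∃ p : Fin d → ℤ, ∀ i, |(q : ℝ) * x i - p i| ≤ 2 * (Q : ℝ) ^ (-v i) := by
  have hQ1 : (1 : ℝ) ≤ Q := by exact_mod_cast hQ
  have hQ0 : (0 : ℝ) < Q := by linarith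
  set N : Fin d → ℕ := fun i => ⌊(Q : ℝ) ^ (v i)⌋₊ with hN
  have hy : ∀ i, (1 : ℝ) ≤ (Q : ℝ) ^ (v i) := fun i => Real.one_le_rpow hQ1 (hv i).le
  have hN1 : ∀ i, 1 ≤ N i := fun i => Nat.one_le_floor_iff _ |>.2 (hy i)
  have hN1' : ∀ i, (1 : ℝ) ≤ N i := fun i => by exact_mod_cast hN1 i
  have hNle : ∀ i, (N i : ℝ) ≤ (Q : ℝ) ^ (v i) := fun i => Nat.floor_le (by positivity)
  have hNge : ∀ i, 1 / (N i : ℝ) ≤ 2 * (Q : ℝ) ^ (-v i) := by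
    intro i
    have h1 : (Q : ℝ) ^ (v i) < N i + 1 := Nat.lt_floor_add_one _
    rw [Real.rpow_neg hQ0.le, ← div_eq_mul_inv, div_le_div_iff₀ (by linarith [hN1' i]) (by positivity)]
    linarith [hN1' i]
  have hprod : ∏ i, N i ≤ Q := by
    have : ((∏ i, N i : ℕ) : ℝ) ≤ Q := by
      push_cast
      calc ∏ i, (N i : ℝ) ≤ ∏ i, (Q : ℝ) ^ (v i) :=
            Finset.prod_le_prod (fun i _ => by positivity) (fun i _ => hNle i)
        _ = Q := by rw [← Real.rpow_sum_of_pos hQ0, hsum, Real.rpow_one]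
    exact_mod_cast this
  set f : ℕ → (Fin d → ℕ) := fun k i => ⌊(N i : ℝ) * Int.fract ((k : ℝ) * x i)⌋₊ with hf
  obtain ⟨k1, hk1, k2, hk2, hne, heq⟩ : ∃ k1 ∈ Finset.range (Q + 1), ∃ k2 ∈ Finset.range (Q + 1),
      k1 ≠ k2 ∧ f k1 = f k2 := by
    apply Finset.exists_ne_map_eq_of_card_lt_of_maps_to
      (t := Fintype.piFinset fun i => Finset.range (N i))
    · rw [Fintype.card_piFinset, Finset.card_range]
      simp only [Finset.card_range]
      omega
    · intro k _
      simp only [Finset.mem_coe, Fintype.mem_piFinset, Finset.mem_range, hf]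
      intro i
      rw [Nat.floor_lt (mul_nonneg (by positivity) (Int.fract_nonneg _))]
      have := Int.fract_lt_one ((k : ℝ) * x i)
      have := hN1' i
      nlinarith
  have key : ∀ k1 k2 : ℕ, k1 < k2 → k2 ≤ Q → f k1 = f k2 → ∃ q : ℕ, 1 ≤ q ∧ q ≤ Q ∧
      ∃ p : Fin d → ℤ, ∀ i, |(q : ℝ) * x i - p i| ≤ 2 * (Q : ℝ) ^ (-v i) := by
    intro k1 k2 hlt hle heq
    refine ⟨k2 - k1, by omega, by omega, fun i => ⌊(k2 : ℝ) * x i⌋ - ⌊(k1 : ℝ) * x i⌋, fun i => ?_⟩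
    refine le_trans ?_ (hNge i)
    have h1 := congrFun heq i
    simp only [hf] at h1
    set α := Int.fract ((k1 : ℝ) * x i) with hα
    set β := Int.fract ((k2 : ℝ) * x i) with hβ
    have hα0 : 0 ≤ α := Int.fract_nonneg _
    have hβ0 : 0 ≤ β := Int.fract_nonneg _
    have hNi := hN1' i
    have a1 := Nat.floor_le (mul_nonneg (by positivity : (0 : ℝ) ≤ N i) hα0)
    have a2 := Nat.lt_floor_add_one ((N i : ℝ) * α)
    have b1 := Nat.floor_le (mul_nonneg (by positivity : (0 : ℝ) ≤ N i) hβ0)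
    have b2 := Nat.lt_floor_add_one ((N i : ℝ) * β)
    rw [h1] at a1 a2
    have e : ((k2 - k1 : ℕ) : ℝ) * x i - ((⌊(k2 : ℝ) * x i⌋ - ⌊(k1 : ℝ) * x i⌋ : ℤ) : ℝ) = β - α := by
      rw [Nat.cast_sub hlt.le, hα, hβ, Int.fract, Int.fract]
      push_cast
      ring
    have hpos : (0 : ℝ) < N i := by linarith
    rw [e, abs_le]
    constructor
    · have : -(1 / (N i : ℝ)) = (-1) / N i := by ring
      rw [this, div_le_iff₀ hpos]; nlinarith
    · rw [le_div_iff₀ hpos]; nlinarith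
  rw [Finset.mem_range] at hk1 hk2
  rcases lt_or_gt_of_ne hne with h | h
  · exact key k1 k2 h (by omega) heq
  · exact key k2 k1 h (by omega) heq.symm

namespace Par
variable {d : ℕ} (P : Par d)

/-- lower ratio between `q` and `Q` -/
noncomputable def c (_ : Par d) : ℝ := 1 / (16 * 8 ^ d)

/-- separation constant -/
noncomputable def κ (_ : Par d) : ℝ := 1 / 40000

theorem c_pos : 0 < P.c := by unfold c; positivity
theorem c_le : P.c ≤ 1 := by
  unfold c
  have : (1 : ℝ) ≤ 8 ^ d := one_le_pow₀ (by norm_num)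
  rw [div_le_one (by positivity)]; linarith
theorem κ_pos : 0 < P.κ := by unfold κ; positivity
theorem κ_lt : P.κ < 1 := by unfold κ; norm_num

theorem v_le (i : Fin d) : P.v i ≤ 1 := by
  rw [← P.hvsum]
  exact Finset.single_le_sum (fun j _ => (P.hv j).le) (Finset.mem_univ i)
theorem w_le (i : Fin d) : P.w i ≤ 1 := by
  rw [← P.hwsum]
  exact Finset.single_le_sum (fun j _ => (P.hw j).le) (Finset.mem_univ i)
theorem τw_pos (i : Fin d) : 0 < P.τ * P.w i := mul_pos (by linarith [P.hτ]) (P.hw i)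
theorem bv_le (i : Fin d) : P.b * P.v i ≤ P.τ * P.w i := by
  have := P.hvb i
  have h1 := P.hb
  have h2 := P.hv i
  nlinarith [mul_pos (by linarith : 0 < P.b - 1) (mul_pos (by linarith : 0 < P.b) h2)]
theorem v_le_τw (i : Fin d) : P.v i ≤ P.τ * P.w i := by
  have := P.bv_le i
  have h1 := P.hb
  have h2 := P.hv i
  nlinarith

/-- Good rationals at scale `Q`. -/
def Good (Q : ℕ) (p : Fin d → ℤ) (q : ℕ) : Prop :=
  P.c * Q ≤ q ∧ q ≤ Q ∧ 0 < q ∧ ∀ r : ℕ, 0 < r → r < q → ∀ s : Fin d → ℤ,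
    ∃ i, P.κ * (Q : ℝ) ^ (-P.v i) ≤ |(r : ℝ) * (p i / q) - s i|

variable {P}

theorem Good.qpos {Q : ℕ} {p : Fin d → ℤ} {q : ℕ} (h : P.Good Q p q) : (0 : ℝ) < q := by
  exact_mod_cast h.2.2.1
theorem Good.one_le {Q : ℕ} {p : Fin d → ℤ} {q : ℕ} (h : P.Good Q p q) : (1 : ℝ) ≤ q := by
  exact_mod_cast h.2.2.1
theorem Good.qle {Q : ℕ} {p : Fin d → ℤ} {q : ℕ} (h : P.Good Q p q) : (q : ℝ) ≤ Q := by
  exact_mod_cast h.2.1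
theorem Good.Q_one_le {Q : ℕ} {p : Fin d → ℤ} {q : ℕ} (h : P.Good Q p q) : (1 : ℝ) ≤ Q :=
  h.one_le.trans h.qle

theorem κQ_lt (P : Par d) {Q : ℝ} (hQ : 1 ≤ Q) (i : Fin d) : P.κ * Q ^ (-P.v i) < 1 := by
  have h1 : Q ^ (-P.v i) ≤ 1 :=
    Real.rpow_le_one_of_one_le_of_nonpos hQ (by linarith [P.hv i])
  have := P.κ_pos
  have := P.κ_lt
  nlinarith

theorem Good.int {Q : ℕ} {p : Fin d → ℤ} {q : ℕ} (h : P.Good Q p q) (r : ℤ) (s : Fin d → ℤ)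
    (hr : |r| < q) (hne : r ≠ 0 ∨ s ≠ 0) :
    ∃ i, P.κ * (Q : ℝ) ^ (-P.v i) ≤ |(r : ℝ) * (p i / q) - s i| := by
  by_cases hr0 : r = 0
  · have hs : s ≠ 0 := by tauto
    obtain ⟨i, hi⟩ := Function.ne_iff.1 hs
    refine ⟨i, ?_⟩
    rw [hr0]
    have h1 : (1 : ℝ) ≤ |(s i : ℝ)| := by
      have : (1 : ℤ) ≤ |s i| := Int.one_le_abs hi
      exact_mod_cast this
    simp only [Int.cast_zero, zero_mul, zero_sub, abs_neg]
    linarith [κQ_lt P h.Q_one_le i]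
  · rcases lt_or_gt_of_ne hr0 with hneg | hpos
    · obtain ⟨i, hi⟩ := h.2.2.2 r.natAbs (by omega) (by rw [abs_of_neg hneg] at hr; omega) (-s)
      refine ⟨i, hi.trans (le_of_eq ?_)⟩
      have : ((r.natAbs : ℕ) : ℝ) = -(r : ℝ) := by
        have : ((r.natAbs : ℕ) : ℤ) = -r := by omega
        rw [← Int.cast_natCast, this, Int.cast_neg]
      rw [this, ← abs_neg]
      congr 1
      simp only [Pi.neg_apply, Int.cast_neg]
      ring
    · obtain ⟨i, hi⟩ := h.2.2.2 r.natAbs (by omega) (by rw [abs_of_pos hpos] at hr; omega) s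
      refine ⟨i, hi.trans (le_of_eq ?_)⟩
      have : ((r.natAbs : ℕ) : ℝ) = (r : ℝ) := by
        have : ((r.natAbs : ℕ) : ℤ) = r := by omega
        rw [← Int.cast_natCast, this]
      rw [this]

theorem Good.all {Q : ℕ} {p : Fin d → ℤ} {q : ℕ} (h : P.Good Q p q) (r : ℕ) (s : Fin d → ℤ) :
    (∃ m : ℕ, r = m * q ∧ ∀ i, s i = m * p i) ∨
    ∃ i, P.κ * (Q : ℝ) ^ (-P.v i) ≤ |(r : ℝ) * (p i / q) - s i| := by
  by_cases hc : r % q = 0 ∧ (fun i => s i - (r / q : ℕ) * p i) = 0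
  · left
    refine ⟨r / q, ?_, fun i => ?_⟩
    · have := Nat.div_add_mod r q
      rw [hc.1] at this
      rw [mul_comm]; omega
    · have := congrFun hc.2 i
      simp only [Pi.zero_apply] at this
      linarith
  · right
    obtain ⟨i, hi⟩ := h.int ((r % q : ℕ) : ℤ) (fun i => s i - (r / q : ℕ) * p i)
      (by rw [abs_of_nonneg (by positivity)]; exact_mod_cast Nat.mod_lt _ h.2.2.1)
      (by
        by_contra hcon
        push Not at hcon
        exact hc ⟨by exact_mod_cast hcon.1, hcon.2⟩)
    refine ⟨i, hi.trans (le_of_eq ?_)⟩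
    congr 1
    have h1 : (r : ℝ) = q * ((r / q : ℕ) : ℝ) + ((r % q : ℕ) : ℝ) := by
      exact_mod_cast (Nat.div_add_mod r q).symm
    have := h.qpos
    rw [h1, Int.cast_sub, Int.cast_mul, Int.cast_natCast, Int.cast_natCast]
    field_simp
    ring

/-- distinct good rationals are separated -/
theorem Good.sep {Q : ℕ} {p p' : Fin d → ℤ} {q q' : ℕ} (h : P.Good Q p q) (h' : P.Good Q p' q')
    (hne : (p, q) ≠ (p', q')) :
    ∃ i, P.κ * (Q : ℝ) ^ (-(1 + P.v i)) ≤ |(p i : ℝ) / q - p' i / q'| := by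
  have key : ∀ {p p' : Fin d → ℤ} {q q' : ℕ}, P.Good Q p q → P.Good Q p' q' → (p, q) ≠ (p', q') →
      q' ≤ q → ∃ i, P.κ * (Q : ℝ) ^ (-(1 + P.v i)) ≤ |(p i : ℝ) / q - p' i / q'| := by
    intro p p' q q' h h' hne hle
    have hq' := h'.qpos
    have hQ : (0 : ℝ) < Q := lt_of_lt_of_le hq' h'.qle
    have fin : ∀ i, P.κ * (Q : ℝ) ^ (-P.v i) ≤ |(q' : ℝ) * (p i / q) - p' i| →
        P.κ * (Q : ℝ) ^ (-(1 + P.v i)) ≤ |(p i : ℝ) / q - p' i / q'| := by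
      intro i hi
      have e : (p i : ℝ) / q - p' i / q' = ((q' : ℝ) * (p i / q) - p' i) / q' := by field_simp
      rw [e, abs_div, abs_of_pos hq', le_div_iff₀ hq']
      refine le_trans ?_ hi
      have : (Q : ℝ) ^ (-(1 + P.v i)) = (Q : ℝ) ^ (-P.v i) / Q := by
        rw [neg_add_rev, Real.rpow_add hQ, Real.rpow_neg_one]; rfl
      rw [this]
      have h1 : P.κ * ((Q : ℝ) ^ (-P.v i) / Q) * q' ≤ P.κ * ((Q : ℝ) ^ (-P.v i) / Q) * Q := by
        have := P.κ_pos
        have := h'.qle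
        gcongr
      refine h1.trans (le_of_eq ?_)
      field_simp
    rcases Nat.lt_or_ge q' q with hlt | hge
    · obtain ⟨i, hi⟩ := h.2.2.2 q' h'.2.2.1 hlt p'
      exact ⟨i, fin i hi⟩
    · have hqq : q' = q := le_antisymm hle hge
      subst hqq
      have hpp : p ≠ p' := fun hpp => hne (by rw [hpp])
      obtain ⟨i, hi⟩ := Function.ne_iff.1 hpp
      refine ⟨i, fin i ?_⟩
      have e : (q' : ℝ) * (p i / q') - p' i = ((p i - p' i : ℤ) : ℝ) := by
        push_cast; field_simp
      rw [e]
      have h1 : (1 : ℝ) ≤ |((p i - p' i : ℤ) : ℝ)| := by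
        have : (1 : ℤ) ≤ |p i - p' i| := Int.one_le_abs (sub_ne_zero.2 hi)
        exact_mod_cast this
      linarith [κQ_lt P h.Q_one_le i]
  rcases le_total q' q with hle | hle
  · exact key h h' hne hle
  · obtain ⟨i, hi⟩ := key h' h hne.symm hle
    exact ⟨i, by rwa [abs_sub_comm]⟩

theorem good_of_short (P : Par d) (x : Fin d → ℝ) (Q : ℕ) (hQ : 1 ≤ Q)
    (h1 : ¬ ∃ r : ℕ, 1 ≤ r ∧ (r : ℝ) ≤ 1 * Q ∧
          ∃ s : Fin d → ℤ, ∀ i, |(r : ℝ) * x i - s i| ≤ (1 / 64) * (Q : ℝ) ^ (-P.v i))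
    (h2 : ¬ ∃ r : ℕ, 1 ≤ r ∧ (r : ℝ) ≤ P.c * Q ∧
          ∃ s : Fin d → ℤ, ∀ i, |(r : ℝ) * x i - s i| ≤ 2 * (Q : ℝ) ^ (-P.v i)) :
    ∃ (p : Fin d → ℤ) (q : ℕ), P.Good Q p q ∧ ∀ i, |(q : ℝ) * x i - p i| ≤ 2 * (Q : ℝ) ^ (-P.v i) := by
  classical
  have hQ1 : (1 : ℝ) ≤ Q := by exact_mod_cast hQ
  have hQ0 : (0 : ℝ) < Q := by linarith
  have hex : ∃ q : ℕ, 1 ≤ q ∧ q ≤ Q ∧ ∃ p : Fin d → ℤ, ∀ i, |(q : ℝ) * x i - p i| ≤ 2 * (Q : ℝ) ^ (-P.v i) :=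
    dirichlet_v P.v P.hv P.hvsum x Q hQ
  obtain ⟨hq1, hqQ, p, hp⟩ := Nat.find_spec hex
  have hmin := fun m (hm : m < Nat.find hex) => Nat.find_min hex hm
  set q := Nat.find hex with hqdef
  have hqpos : (0 : ℝ) < q := by exact_mod_cast hq1
  refine ⟨p, q, ⟨?_, hqQ, hq1, ?_⟩, hp⟩
  · by_contra hcon
    exact h2 ⟨q, hq1, (not_le.1 hcon).le, p, hp⟩
  · intro r hr0 hrq s
    by_contra hcon
    push Not at hcon
    obtain ⟨j, k, hk0, hkn, hjk⟩ := Real.exists_int_int_abs_mul_sub_le ((r : ℝ) / q) (n := 255) (by norm_num)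
    have hkpos : (0 : ℝ) < k := by exact_mod_cast hk0
    have hk255 : (k : ℝ) ≤ 255 := by exact_mod_cast hkn
    set R : ℤ := k * r - j * q with hR
    set S : Fin d → ℤ := fun i => k * s i - j * p i with hS
    have hRS : ∀ i, (R : ℝ) * (p i / q) - S i = k * ((r : ℝ) * (p i / q) - s i) := by
      intro i
      simp only [hR, hS]; push_cast; field_simp; ring
    have hsmall : ∀ i, |(R : ℝ) * (p i / q) - S i| ≤ 255 * (P.κ * (Q : ℝ) ^ (-P.v i)) := by
      intro i
      rw [hRS, abs_mul, abs_of_pos hkpos]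
      have := (hcon i).le
      gcongr
    have hRle : |(R : ℝ)| ≤ q / 256 := by
      have e : (R : ℝ) = q * (k * ((r : ℝ) / q) - j) := by
        simp only [hR]; push_cast; field_simp
      rw [e, abs_mul, abs_of_pos hqpos]
      norm_num at hjk
      nlinarith
    by_cases hR0 : R = 0
    · have hS0 : ∀ i, S i = 0 := by
        intro i
        have h3 := hsmall i
        rw [hR0] at h3
        simp only [Int.cast_zero, zero_mul, zero_sub, abs_neg] at h3
        by_contra hne
        have h4 : (1 : ℝ) ≤ |(S i : ℝ)| := by
          have : (1 : ℤ) ≤ |S i| := Int.one_le_abs hne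
          exact_mod_cast this
        have h5 : (Q : ℝ) ^ (-P.v i) ≤ 1 :=
          Real.rpow_le_one_of_one_le_of_nonpos hQ1 (by linarith [P.hv i])
        unfold κ at h3
        linarith
      apply hmin r hrq
      refine ⟨hr0, by omega, s, fun i => ?_⟩
      have e1 : (k : ℝ) * r = j * q := by
        have : k * r = j * q := by simp only [hR] at hR0; omega
        exact_mod_cast this
      have e2 : (k : ℝ) * s i = j * p i := by
        have : k * s i = j * p i := by have := hS0 i; simp only [hS] at this; omega
        exact_mod_cast this
      have e3 : (r : ℝ) * x i - s i = (r / q : ℝ) * (q * x i - p i) := by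
        have hk' : (k : ℝ) ≠ 0 := hkpos.ne'
        have e4 : (s i : ℝ) = r / q * p i := by
          have : (k : ℝ) * s i = k * (r / q * p i) := by
            rw [e2, ← mul_assoc, ← mul_div_assoc, e1]; field_simp
          exact mul_left_cancel₀ hk' this
        rw [e4]; field_simp
      rw [e3, abs_mul, abs_of_nonneg (by positivity)]
      have h6 : (r / q : ℝ) ≤ 1 := by
        rw [div_le_one hqpos]; exact_mod_cast hrq.le
      have h7 := hp i
      have h8 := abs_nonneg ((q : ℝ) * x i - p i)
      nlinarith
    · have hfin : ∀ i, |(R : ℝ) * x i - S i| ≤ (1 / 64) * (Q : ℝ) ^ (-P.v i) := by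
        intro i
        have e : (R : ℝ) * x i - S i = ((R : ℝ) * (p i / q) - S i) + (R / q) * (q * x i - p i) := by
          field_simp; ring
        have h3 : |(R / q : ℝ) * (q * x i - p i)| ≤ (1 / 256) * (2 * (Q : ℝ) ^ (-P.v i)) := by
          rw [abs_mul, abs_div, abs_of_pos hqpos]
          have : |(R : ℝ)| / q ≤ 1 / 256 := by
            rw [div_le_iff₀ hqpos]; linarith
          have := hp i
          gcongr
        rw [e]
        refine (abs_add_le _ _).trans ?_
        have h4 := hsmall i
        unfold κ at h4
        have h5 : 0 ≤ (Q : ℝ) ^ (-P.v i) := by positivity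
        linarith
      apply h1
      have hRabs : ((R.natAbs : ℕ) : ℝ) = |(R : ℝ)| := by
        rw [← Int.cast_natCast, Int.natCast_natAbs, Int.cast_abs]
      have hqQ' : (q : ℝ) ≤ Q := by exact_mod_cast hqQ
      refine ⟨R.natAbs, by omega, ?_, ?_⟩
      · rw [hRabs]; linarith
      · rcases lt_or_gt_of_ne hR0 with hneg | hpos
        · refine ⟨-S, fun i => ?_⟩
          rw [hRabs, abs_of_neg (by exact_mod_cast hneg : (R : ℝ) < 0)]
          have := hfin i
          rw [← abs_neg] at this
          convert this using 2
          simp only [Pi.neg_apply, Int.cast_neg]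
          ring
        · refine ⟨S, fun i => ?_⟩
          rw [hRabs, abs_of_pos (by exact_mod_cast hpos : (0 : ℝ) < R)]
          exact hfin i

end Par

open Real MeasureTheory Set Filter Topology

theorem card_sep {d : ℕ} {ι : Type*} (Z : Set ι) (φ : ι → Fin d → ℝ) (A L g : Fin d → ℝ)
    (hg : ∀ i, 0 < g i) (hL : ∀ i, 0 ≤ L i) (hmem : ∀ z ∈ Z, ∀ i, φ z i ∈ Icc (A i) (A i + L i))
    (hsep : ∀ z ∈ Z, ∀ z' ∈ Z, z ≠ z' → ∃ i, g i ≤ |φ z i - φ z' i|) :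
    ∃ F : Finset ι, (F : Set ι) = Z ∧ (F.card : ℝ) ≤ ∏ i, (L i / g i + 1) := by
  classical
  set f : ι → Fin d → ℕ := fun z i => ⌊(φ z i - A i) / g i⌋₊ with hf
  set T : Finset (Fin d → ℕ) := Fintype.piFinset fun i => Finset.range (⌊L i / g i⌋₊ + 1) with hT
  have hmaps : ∀ z ∈ Z, f z ∈ T := by
    intro z hz
    rw [hT, Fintype.mem_piFinset]
    intro i
    rw [Finset.mem_range, Nat.lt_succ_iff]
    apply Nat.floor_le_floor
    have := (hmem z hz i).2
    have := hg i
    gcongr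
    linarith
  have hinj : InjOn f Z := by
    intro z hz z' hz' heq
    by_contra hne
    obtain ⟨i, hi⟩ := hsep z hz z' hz' hne
    have h1 := congrFun heq i
    simp only [hf] at h1
    have hgi := hg i
    have p1 : 0 ≤ (φ z i - A i) / g i := div_nonneg (by linarith [(hmem z hz i).1]) hgi.le
    have p2 : 0 ≤ (φ z' i - A i) / g i := div_nonneg (by linarith [(hmem z' hz' i).1]) hgi.le
    have a1 := Nat.floor_le p1
    have a2 := Nat.lt_floor_add_one ((φ z i - A i) / g i)
    have b1 := Nat.floor_le p2
    have b2 := Nat.lt_floor_add_one ((φ z' i - A i) / g i)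
    rw [h1] at a1 a2
    have e : (φ z i - φ z' i) = g i * ((φ z i - A i) / g i - (φ z' i - A i) / g i) := by
      field_simp; ring
    have : |(φ z i - A i) / g i - (φ z' i - A i) / g i| < 1 := by
      rw [abs_lt]; constructor <;> linarith
    rw [e, abs_mul, abs_of_pos hgi] at hi
    nlinarith
  have hfin : Z.Finite := Set.Finite.of_injOn (t := (T : Set (Fin d → ℕ))) hmaps hinj T.finite_toSet
  refine ⟨hfin.toFinset, by simp, ?_⟩
  have hcard : hfin.toFinset.card ≤ T.card := by
    apply Finset.card_le_card_of_injOn f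
    · intro z hz
      exact hmaps z (by simpa using hz)
    · simpa using hinj
  have hTc : (T.card : ℝ) ≤ ∏ i, (L i / g i + 1) := by
    rw [hT, Fintype.card_piFinset]
    push_cast
    apply Finset.prod_le_prod
    · intro i _; positivity
    · intro i _
      rw [Finset.card_range]
      push_cast
      have := Nat.floor_le (div_nonneg (hL i) (hg i).le)
      linarith
  refine le_trans ?_ hTc
  exact_mod_cast hcard

theorem vol_cbox {d : ℕ} (a b : Fin d → ℝ) :
    volume {x : Fin d → ℝ | ∀ i, x i ∈ Icc (a i) (b i)} = ∏ i, ENNReal.ofReal (b i - a i) := by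
  have : {x : Fin d → ℝ | ∀ i, x i ∈ Icc (a i) (b i)} = Set.pi univ (fun i => Icc (a i) (b i)) := by
    ext x; simp only [Set.mem_ofPred_eq, Set.mem_pi, Set.mem_univ, forall_const]
  rw [this, volume_pi_pi]
  simp [Real.volume_Icc]

namespace Par
variable {d : ℕ} (P : Par d)

noncomputable def g (q : ℕ) (i : Fin d) : ℝ := (q : ℝ) ^ (-(1 + P.τ * P.w i))

noncomputable def a0 (p : Fin d → ℤ) (q : ℕ) (ε : ℝ) (i : Fin d) : ℝ :=
  (p i : ℝ) / q + (1 - 3 * ε) * P.g q i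

/-- inner box -/
def inner (p : Fin d → ℤ) (q : ℕ) (ε : ℝ) : Set (Fin d → ℝ) :=
  {x | ∀ i, x i ∈ Icc (P.a0 p q ε i) (P.a0 p q ε i + ε * P.g q i)}

/-- outer box -/
def outer (p : Fin d → ℤ) (q : ℕ) (ε : ℝ) : Set (Fin d → ℝ) :=
  {x | ∀ i, x i ∈ Icc ((p i : ℝ) / q + (1 - 4 * ε) * P.g q i) ((p i : ℝ) / q + (1 - ε) * P.g q i)}

/-- few points of the inner box are well approximable with denominators beyond `X` -/
def PX (p : Fin d → ℤ) (q : ℕ) (ε X : ℝ) : Prop :=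
  volume {x : Fin d → ℝ | (∀ i, x i ∈ Icc (P.a0 p q ε i) (P.a0 p q ε i + ε * P.g q i)) ∧
      ∃ r : ℕ, X ≤ r ∧ ∃ s : Fin d → ℤ, ∀ i,
        |(r : ℝ) * x i - s i| ≤ 2 * (r : ℝ) ^ (-(P.τ * P.w i))} ≤
    ENNReal.ofReal ((∏ i, (ε * P.g q i)) / 8)

theorem g_pos {q : ℕ} (hq : 0 < q) (i : Fin d) : 0 < P.g q i := by
  unfold g; have : (0 : ℝ) < q := by exact_mod_cast hq
  positivity

noncomputable def K0 : ℝ := 8 * P.c ^ (-P.τ) / P.κ + 1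

theorem K0_pos : 0 < P.K0 := by
  unfold K0; have := P.c_pos; have := P.κ_pos; positivity

/-- `q^{-τ w_i} ≤ c^{-τ} Q^{-τ w_i}` for good `q` -/
theorem Good.rpow_le {P : Par d} {Q : ℕ} {p : Fin d → ℤ} {q : ℕ} (h : P.Good Q p q) (t : ℝ)
    (ht0 : 0 ≤ t) (T : ℝ) (ht : t ≤ T) :
    (q : ℝ) ^ (-t) ≤ P.c ^ (-T) * (Q : ℝ) ^ (-t) := by
  have hc := P.c_pos
  have hQ : (0 : ℝ) < Q := by linarith [h.Q_one_le]
  calc (q : ℝ) ^ (-t) ≤ (P.c * Q) ^ (-t) :=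
        Real.rpow_le_rpow_of_nonpos (by positivity) h.1 (by linarith)
    _ = P.c ^ (-t) * (Q : ℝ) ^ (-t) := Real.mul_rpow hc.le hQ.le
    _ ≤ _ := by
        gcongr ?_ * _
        exact Real.rpow_le_rpow_of_exponent_ge hc P.c_le (by linarith)

theorem τw_le (i : Fin d) : P.τ * P.w i ≤ P.τ := by
  have := P.w_le i
  have := P.hτ
  nlinarith

theorem sum_τw : ∑ i, P.τ * P.w i = P.τ := by rw [← Finset.mul_sum, P.hwsum, mul_one]

theorem block {P : Par d} {Q : ℕ} {p : Fin d → ℤ} {q : ℕ} (h : P.Good Q p q) (ε : ℝ) (hε0 : 0 < ε)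
    (hε : ε ≤ 1 / 8) (m : ℕ) (hm : 1 ≤ m) :
    volume {x : Fin d → ℝ | (∀ i, x i ∈ Icc (P.a0 p q ε i) (P.a0 p q ε i + ε * P.g q i)) ∧
      ∃ r : ℕ, m * q ≤ r ∧ r < (m + 1) * q ∧ ∃ s : Fin d → ℤ, ∀ i,
        |(r : ℝ) * x i - s i| ≤ 2 * (r : ℝ) ^ (-(P.τ * P.w i))} ≤
    ENNReal.ofReal ((4 * P.K0) ^ d * (m : ℝ) ^ (-P.τ) * ∏ i, P.g q i) := by
  have hq := h.qpos
  have hq1 := h.one_le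
  have hm1 : (1 : ℝ) ≤ m := by exact_mod_cast hm
  have hQ : (0 : ℝ) < Q := by linarith [h.Q_one_le]
  have hκ := P.κ_pos
  have hK0 := P.K0_pos
  have hc := P.c_pos
  set Z : Set (ℕ × (Fin d → ℤ)) := {z | m * q ≤ z.1 ∧ z.1 < (m + 1) * q ∧
    ∀ i, |(z.1 : ℝ) * (p i / q) - z.2 i| ≤ 4 * m * (q : ℝ) ^ (-(P.τ * P.w i))} with hZ
  obtain ⟨F, hF, hFcard⟩ := card_sep Z (fun z i => (z.1 : ℝ) * (p i / q) - z.2 i)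
    (fun i => -(4 * m * (q : ℝ) ^ (-(P.τ * P.w i)))) (fun i => 8 * m * (q : ℝ) ^ (-(P.τ * P.w i)))
    (fun i => P.κ * (Q : ℝ) ^ (-P.v i)) (fun i => by positivity) (fun i => by positivity)
    (by
      intro z hz i
      have := abs_le.1 (hz.2.2 i)
      constructor
      · exact this.1
      · linarith [this.2])
    (by
      intro z hz z' hz' hne
      obtain ⟨i, hi⟩ := h.int ((z.1 : ℤ) - z'.1) (z.2 - z'.2)
        (by
          have h1 := hz.1; have h2 := hz.2.1; have h3 := hz'.1; have h4 := hz'.2.1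
          rw [add_mul, one_mul] at h2 h4
          rw [abs_lt]
          constructor <;> omega)
        (by
          by_contra hcon
          push Not at hcon
          apply hne
          ext1
          · have := hcon.1; omega
          · exact sub_eq_zero.1 hcon.2)
      refine ⟨i, hi.trans (le_of_eq ?_)⟩
      congr 1
      simp only [Pi.sub_apply]
      push_cast
      ring)
  have hcard2 : (F.card : ℝ) ≤ ∏ _i : Fin d, (P.K0 * m) := by
    refine hFcard.trans ?_
    apply Finset.prod_le_prod
    · intro i _; positivity
    · intro i _
      have h1 := h.rpow_le (P.τ * P.w i) (P.τw_pos i).le P.τ (P.τw_le i)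
      have h2 : (Q : ℝ) ^ (-(P.τ * P.w i)) ≤ (Q : ℝ) ^ (-P.v i) :=
        Real.rpow_le_rpow_of_exponent_le h.Q_one_le (by linarith [P.v_le_τw i])
      have h3 : (q : ℝ) ^ (-(P.τ * P.w i)) ≤ P.c ^ (-P.τ) * (Q : ℝ) ^ (-P.v i) :=
        h1.trans (by gcongr)
      have h4 : 8 * m * (q : ℝ) ^ (-(P.τ * P.w i)) / (P.κ * (Q : ℝ) ^ (-P.v i)) ≤
          8 * P.c ^ (-P.τ) / P.κ * m := by
        rw [div_le_iff₀ (by positivity)]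
        calc 8 * m * (q : ℝ) ^ (-(P.τ * P.w i)) ≤ 8 * m * (P.c ^ (-P.τ) * (Q : ℝ) ^ (-P.v i)) := by
              gcongr
          _ = _ := by field_simp
      unfold K0
      linarith
  have hsub : {x : Fin d → ℝ | (∀ i, x i ∈ Icc (P.a0 p q ε i) (P.a0 p q ε i + ε * P.g q i)) ∧
      ∃ r : ℕ, m * q ≤ r ∧ r < (m + 1) * q ∧ ∃ s : Fin d → ℤ, ∀ i,
        |(r : ℝ) * x i - s i| ≤ 2 * (r : ℝ) ^ (-(P.τ * P.w i))} ⊆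
      ⋃ z ∈ F, {x : Fin d → ℝ | ∀ i, x i ∈ Icc (((z.2 i : ℝ) - 2 * (z.1 : ℝ) ^ (-(P.τ * P.w i))) / z.1)
        (((z.2 i : ℝ) + 2 * (z.1 : ℝ) ^ (-(P.τ * P.w i))) / z.1)} := by
    rintro x ⟨hx, r, hr1, hr2, s, hs⟩
    have hmq : ((m * q : ℕ) : ℝ) ≤ r := by exact_mod_cast hr1
    have hmq2 : (r : ℝ) ≤ ((m : ℝ) + 1) * q := by exact_mod_cast hr2.le
    push_cast at hmq
    have hqr : (q : ℝ) ≤ r := by nlinarith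
    have hrpos : (0 : ℝ) < r := by linarith
    simp only [mem_iUnion]
    refine ⟨(r, s), ?_, ?_⟩
    · rw [← Finset.mem_coe, hF, hZ]
      refine ⟨hr1, hr2, fun i => ?_⟩
      have hxi := hx i
      have hgp := P.g_pos h.2.2.1 i
      have hd1 : |x i - p i / q| ≤ P.g q i := by
        unfold a0 at hxi
        rw [abs_le]
        constructor
        · nlinarith [hxi.1]
        · nlinarith [hxi.2]
      have hgq : P.g q i = (q : ℝ) ^ (-(P.τ * P.w i)) / q := by
        unfold g
        rw [neg_add_rev, Real.rpow_add hq, Real.rpow_neg_one]; rfl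
      have e : (r : ℝ) * (p i / q) - s i = (r * x i - s i) - r * (x i - p i / q) := by ring
      simp only
      rw [e]
      refine (abs_sub _ _).trans ?_
      have t1 : (r : ℝ) ^ (-(P.τ * P.w i)) ≤ (q : ℝ) ^ (-(P.τ * P.w i)) :=
        Real.rpow_le_rpow_of_nonpos hq hqr (by linarith [P.τw_pos i])
      have t2 : |(r : ℝ) * (x i - p i / q)| ≤ ((m : ℝ) + 1) * (q : ℝ) ^ (-(P.τ * P.w i)) := by
        rw [abs_mul, abs_of_pos hrpos]
        calc (r : ℝ) * |x i - p i / q| ≤ (((m : ℝ) + 1) * q) * P.g q i := by gcongr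
          _ = _ := by rw [hgq]; field_simp
      have t3 : 0 < (q : ℝ) ^ (-(P.τ * P.w i)) := by positivity
      have t4 := hs i
      nlinarith
    · intro i
      have := abs_le.1 (hs i)
      constructor
      · simp only
        rw [div_le_iff₀ hrpos]; linarith
      · simp only
        rw [le_div_iff₀ hrpos]; linarith
  have hvol : ∀ z ∈ F, volume {x : Fin d → ℝ | ∀ i, x i ∈ Icc (((z.2 i : ℝ) - 2 * (z.1 : ℝ) ^ (-(P.τ * P.w i))) / z.1)
        (((z.2 i : ℝ) + 2 * (z.1 : ℝ) ^ (-(P.τ * P.w i))) / z.1)} ≤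
      ENNReal.ofReal (∏ i, (4 * (m : ℝ) ^ (-(1 + P.τ * P.w i)) * P.g q i)) := by
    intro z hz
    rw [← Finset.mem_coe, hF] at hz
    have hmq : ((m * q : ℕ) : ℝ) ≤ z.1 := by exact_mod_cast hz.1
    push_cast at hmq
    have hrpos : (0 : ℝ) < z.1 := by nlinarith
    rw [vol_cbox, ENNReal.ofReal_prod_of_nonneg (fun i _ => by have := P.g_pos h.2.2.1 i; positivity)]
    apply Finset.prod_le_prod'
    intro i _
    apply ENNReal.ofReal_le_ofReal
    have e : ((z.2 i : ℝ) + 2 * (z.1 : ℝ) ^ (-(P.τ * P.w i))) / z.1 -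
        ((z.2 i : ℝ) - 2 * (z.1 : ℝ) ^ (-(P.τ * P.w i))) / z.1 = 4 * (z.1 : ℝ) ^ (-(1 + P.τ * P.w i)) := by
      rw [neg_add_rev, Real.rpow_add hrpos, Real.rpow_neg_one]
      field_simp; ring
    rw [e, mul_assoc]
    unfold g
    rw [← Real.mul_rpow (by positivity) (by positivity)]
    have := Real.rpow_le_rpow_of_nonpos (by positivity) hmq
      (by linarith [P.τw_pos i] : -(1 + P.τ * P.w i) ≤ 0)
    linarith
  refine (measure_mono hsub).trans ((measure_biUnion_finset_le _ _).trans
    ((Finset.sum_le_sum hvol).trans ?_))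
  rw [Finset.sum_const, nsmul_eq_mul, ← ENNReal.ofReal_natCast, ← ENNReal.ofReal_mul (by positivity)]
  apply ENNReal.ofReal_le_ofReal
  have hgp : ∀ i, 0 < P.g q i := P.g_pos h.2.2.1
  have hprod0 : 0 ≤ ∏ i, (4 * (m : ℝ) ^ (-(1 + P.τ * P.w i)) * P.g q i) :=
    Finset.prod_nonneg fun i _ => by have := hgp i; positivity
  refine (mul_le_mul_of_nonneg_right hcard2 hprod0).trans (le_of_eq ?_)
  have hmp : (0 : ℝ) < m := by linarith
  have e1 : (m : ℝ) ^ (-P.τ) = ∏ i, (m : ℝ) ^ (-(P.τ * P.w i)) := by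
    rw [← Real.rpow_sum_of_pos hmp, Finset.sum_neg_distrib, P.sum_τw]
  have e2 : (4 * P.K0) ^ d = ∏ _i : Fin d, (4 * P.K0) := by simp
  rw [e1, e2, ← Finset.prod_mul_distrib, ← Finset.prod_mul_distrib, ← Finset.prod_mul_distrib]
  apply Finset.prod_congr rfl
  intro i _
  rw [neg_add_rev, Real.rpow_add hmp, Real.rpow_neg_one]
  field_simp

theorem PX_of_good (ε : ℝ) (hε0 : 0 < ε) (hε : ε ≤ 1 / 8) :
    ∀ᶠ Q : ℕ in atTop, ∀ (p : Fin d → ℤ) (q : ℕ), P.Good Q p q → P.PX p q ε ((Q : ℝ) ^ (1 + P.δ)) := by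
  have hK0 := P.K0_pos
  set f : ℕ → ℝ := fun m => (4 * P.K0) ^ d * (m : ℝ) ^ (-P.τ) with hf
  have hfs : Summable f := by
    apply Summable.mul_left
    rw [Real.summable_nat_rpow]
    linarith [P.hτ]
  have hf0 : ∀ r, 0 ≤ f r := fun r => by positivity
  have hlim := ENNReal.tendsto_sum_nat_add (fun r => ENNReal.ofReal (f r)) hfs.tsum_ofReal_ne_top
  have hev := (ENNReal.tendsto_nhds_zero.1 hlim) (ENNReal.ofReal (ε ^ d / 8)) (by simp; positivity)
  obtain ⟨M, hM, hM1⟩ := (hev.and (eventually_ge_atTop 1)).exists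
  have hbig : ∀ᶠ Q : ℕ in atTop, (M : ℝ) + 1 ≤ (Q : ℝ) ^ P.δ :=
    ((tendsto_rpow_atTop P.hδ).comp tendsto_natCast_atTop_atTop).eventually_ge_atTop _
  filter_upwards [hbig] with Q hQ p q h
  have hq := h.qpos
  have hQ0 : (0 : ℝ) < Q := by linarith [h.Q_one_le]
  unfold PX
  have hsub : {x : Fin d → ℝ | (∀ i, x i ∈ Icc (P.a0 p q ε i) (P.a0 p q ε i + ε * P.g q i)) ∧
      ∃ r : ℕ, (Q : ℝ) ^ (1 + P.δ) ≤ r ∧ ∃ s : Fin d → ℤ, ∀ i,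
        |(r : ℝ) * x i - s i| ≤ 2 * (r : ℝ) ^ (-(P.τ * P.w i))} ⊆
      ⋃ k : ℕ, {x : Fin d → ℝ | (∀ i, x i ∈ Icc (P.a0 p q ε i) (P.a0 p q ε i + ε * P.g q i)) ∧
      ∃ r : ℕ, (k + M) * q ≤ r ∧ r < ((k + M) + 1) * q ∧ ∃ s : Fin d → ℤ, ∀ i,
        |(r : ℝ) * x i - s i| ≤ 2 * (r : ℝ) ^ (-(P.τ * P.w i))} := by
    rintro x ⟨hx, r, hr, s, hs⟩
    rw [mem_iUnion]
    have hMr : M ≤ r / q := by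
      rw [Nat.le_div_iff_mul_le h.2.2.1]
      have : ((M * q : ℕ) : ℝ) ≤ r := by
        refine le_trans ?_ hr
        rw [Real.rpow_add hQ0, Real.rpow_one]
        push_cast
        have := h.qle
        nlinarith
      exact_mod_cast this
    refine ⟨r / q - M, hx, r, ?_, ?_, s, hs⟩
    · rw [Nat.sub_add_cancel hMr]; exact Nat.div_mul_le_self r q
    · rw [Nat.sub_add_cancel hMr]
      exact (Nat.div_lt_iff_lt_mul h.2.2.1).1 (Nat.lt_succ_self _)
  have hgp : ∀ i, 0 < P.g q i := P.g_pos h.2.2.1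
  have hG : 0 ≤ ∏ i, P.g q i := Finset.prod_nonneg fun i _ => (hgp i).le
  refine (measure_mono hsub).trans ((measure_iUnion_le _).trans ?_)
  calc _ ≤ ∑' k : ℕ, ENNReal.ofReal (f (k + M)) * ENNReal.ofReal (∏ i, P.g q i) := by
        apply ENNReal.tsum_le_tsum
        intro k
        rw [← ENNReal.ofReal_mul (hf0 _)]
        have := block h ε hε0 hε (k + M) (by omega)
        exact this
    _ = (∑' k : ℕ, ENNReal.ofReal (f (k + M))) * ENNReal.ofReal (∏ i, P.g q i) := ENNReal.tsum_mul_right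
    _ ≤ ENNReal.ofReal (ε ^ d / 8) * ENNReal.ofReal (∏ i, P.g q i) := by gcongr
    _ = _ := by
        rw [← ENNReal.ofReal_mul (by positivity), Finset.prod_mul_distrib]
        congr 1
        simp
        ring

theorem PX_start (ε : ℝ) (hε0 : 0 < ε) (p : Fin d → ℤ) (q : ℕ) (hq : 0 < q) :
    ∀ᶠ X : ℕ in atTop, P.PX p q ε X := by
  have hgp : ∀ i, 0 < P.g q i := P.g_pos hq
  have := vol_tail (P.a0 p q ε) (fun i => ε * P.g q i) (fun i => P.τ * P.w i)
    (fun i => by have := hgp i; positivity) P.τw_pos (by rw [P.sum_τw]; exact P.hτ)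
    ((∏ i, (ε * P.g q i)) / 8) (by
      have : 0 < ∏ i, (ε * P.g q i) := Finset.prod_pos fun i _ => by have := hgp i; positivity
      positivity)
  filter_upwards [this] with X hX
  unfold PX
  convert hX using 8
  simp

end Par

open Real MeasureTheory Set Filter Topology

theorem ev_rpow (C t u : ℝ) (htu : t < u) :
    ∀ᶠ Q : ℕ in atTop, C * (Q : ℝ) ^ (-u) ≤ (Q : ℝ) ^ (-t) := by
  have h1 : ∀ᶠ Q : ℕ in atTop, C ≤ (Q : ℝ) ^ (u - t) :=
    ((tendsto_rpow_atTop (by linarith : 0 < u - t)).comp tendsto_natCast_atTop_atTop).eventually_ge_atTop _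
  filter_upwards [h1, eventually_ge_atTop 1] with Q hQ hQ1
  have hQ0 : (0 : ℝ) < Q := by exact_mod_cast hQ1
  calc C * (Q : ℝ) ^ (-u) ≤ (Q : ℝ) ^ (u - t) * (Q : ℝ) ^ (-u) := by gcongr
    _ = _ := by rw [← Real.rpow_add hQ0]; congr 1; ring

namespace Par
variable {d : ℕ} (P : Par d)

noncomputable def C1 : ℝ := 2 / P.c + P.c ^ (-(1 + P.τ))

theorem C1_pos : 0 < P.C1 := by
  unfold C1; have := P.c_pos; positivity

theorem outer_abs {p : Fin d → ℤ} {q : ℕ} (hq : 0 < q) {ε : ℝ} (hε0 : 0 < ε) (hε : ε ≤ 1 / 8)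
    {x : Fin d → ℝ} (hx : x ∈ P.outer p q ε) (i : Fin d) : |x i - p i / q| ≤ P.g q i := by
  have hxi := hx i
  have hgp := P.g_pos hq i
  rw [abs_le]
  constructor
  · nlinarith [hxi.1]
  · nlinarith [hxi.2]

theorem Good.g_le {P : Par d} {Q : ℕ} {p : Fin d → ℤ} {q : ℕ} (h : P.Good Q p q) (i : Fin d) :
    P.g q i ≤ P.c ^ (-(1 + P.τ)) * (Q : ℝ) ^ (-(1 + P.τ * P.w i)) :=
  h.rpow_le _ (by linarith [P.τw_pos i]) _ (by linarith [P.τw_le i])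

theorem Good.near0 {P : Par d} {Q : ℕ} {p : Fin d → ℤ} {q : ℕ} (h : P.Good Q p q) {x : Fin d → ℝ} {i : Fin d}
    (hx : |(q : ℝ) * x i - p i| ≤ 2 * (Q : ℝ) ^ (-P.v i)) :
    |x i - p i / q| ≤ 2 / P.c * (Q : ℝ) ^ (-(1 + P.v i)) := by
  have hq := h.qpos
  have hc := P.c_pos
  have hQ : (0 : ℝ) < Q := by linarith [h.Q_one_le]
  have e : x i - p i / q = (q * x i - p i) / q := by field_simp
  rw [e, abs_div, abs_of_pos hq, div_le_iff₀ hq]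
  refine hx.trans ?_
  rw [neg_add_rev, Real.rpow_add hQ, Real.rpow_neg_one]
  have h1 := h.1
  have h2 : 0 < (Q : ℝ) ^ (-P.v i) := by positivity
  calc 2 * (Q : ℝ) ^ (-P.v i) = 2 / P.c * ((Q : ℝ) ^ (-P.v i) * (Q : ℝ)⁻¹) * (P.c * Q) := by field_simp
    _ ≤ _ := by gcongr

theorem Good.near {P : Par d} {Q : ℕ} {p : Fin d → ℤ} {q : ℕ} (h : P.Good Q p q) {x x' : Fin d → ℝ}
    (hx : ∀ i, |(q : ℝ) * x i - p i| ≤ 2 * (Q : ℝ) ^ (-P.v i))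
    {ε : ℝ} (hε0 : 0 < ε) (hε : ε ≤ 1 / 8) (hx' : x' ∈ P.outer p q ε) (i : Fin d) :
    |x i - x' i| ≤ P.C1 * (Q : ℝ) ^ (-(1 + P.v i)) := by
  have h1 := h.near0 (hx i)
  have h2 := P.outer_abs h.2.2.1 hε0 hε hx' i
  have h3 := h.g_le i
  have h4 : (Q : ℝ) ^ (-(1 + P.τ * P.w i)) ≤ (Q : ℝ) ^ (-(1 + P.v i)) :=
    Real.rpow_le_rpow_of_exponent_le h.Q_one_le (by linarith [P.v_le_τw i])
  have h5 : 0 < P.c ^ (-(1 + P.τ)) := by have := P.c_pos; positivity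
  have e : x i - x' i = (x i - p i / q) - (x' i - p i / q) := by ring
  rw [e]
  refine (abs_sub _ _).trans ?_
  unfold C1
  nlinarith

theorem noapprox {P : Par d} {Q : ℕ} {p : Fin d → ℤ} {q : ℕ} (h : P.Good Q p q) {x x' : Fin d → ℝ}
    (hx : ∀ i, |(q : ℝ) * x i - p i| ≤ 2 * (Q : ℝ) ^ (-P.v i))
    {ε : ℝ} (hε0 : 0 < ε) (hε : ε ≤ 1 / 8) (hx' : x' ∈ P.outer p q ε) (X : ℝ) (T : ℕ) (_hT1 : 1 ≤ T)
    (hX : ¬ ∃ r : ℕ, X ≤ r ∧ ∃ s : Fin d → ℤ, ∀ i,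
        |(r : ℝ) * x i - s i| ≤ 2 * (r : ℝ) ^ (-(P.τ * P.w i)))
    (hT : ¬ ∃ r : ℕ, T ≤ r ∧ ∃ s : Fin d → ℤ, ∀ i,
        |(r : ℝ) * x i - s i| ≤ 2 * (r : ℝ) ^ (-(P.b * P.v i)))
    (L1 : ∀ i, T * P.C1 * (Q : ℝ) ^ (-(1 + P.v i)) ≤ (T : ℝ) ^ (-(P.τ * P.w i)))
    (L2 : P.C1 * (Q : ℝ) ^ (P.b⁻¹ - 1) ≤ 1)
    (L3 : ∀ i, P.c ^ (-(1 + P.τ)) * (Q : ℝ) ^ (-(P.b * P.v i)) ≤ P.κ / 2 * (Q : ℝ) ^ (-P.v i))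
    (L4 : ∀ i, (Q : ℝ) ^ (-(P.b * P.v i)) ≤ P.κ / 2 * (Q : ℝ) ^ (-P.v i))
    (r : ℕ) (hXr : X ≤ r) (hrQ : (r : ℝ) ≤ (Q : ℝ) ^ (1 + P.δ)) (s : Fin d → ℤ)
    (hs : ∀ i, |(r : ℝ) * x' i - s i| < (r : ℝ) ^ (-(P.τ * P.w i))) :
    ∃ m : ℕ, r = m * q ∧ ∀ i, s i = m * p i := by
  have hQ : (0 : ℝ) < Q := by linarith [h.Q_one_le]
  have hC1 := P.C1_pos
  have hb := P.hb
  have hb0 : 0 < P.b := by linarith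
  rcases Nat.eq_zero_or_pos r with h0 | hr
  · exfalso
    subst h0
    have := hs ⟨0, P.hd⟩
    rw [Nat.cast_zero, Real.zero_rpow (by linarith [P.τw_pos ⟨0, P.hd⟩])] at this
    exact absurd this (not_lt.2 (abs_nonneg _))
  have hr0 : (0 : ℝ) < r := by exact_mod_cast hr
  have hr1 : (1 : ℝ) ≤ r := by exact_mod_cast hr
  have hnear := h.near hx hε0 hε hx'
  have tri : ∀ i, |(r : ℝ) * x i - s i| ≤ |(r : ℝ) * x' i - s i| + r * (P.C1 * (Q : ℝ) ^ (-(1 + P.v i))) := by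
    intro i
    have e : (r : ℝ) * x i - s i = (r * x' i - s i) + r * (x i - x' i) := by ring
    rw [e]
    refine (abs_add_le _ _).trans ?_
    rw [abs_mul (r : ℝ), abs_of_pos hr0]
    have := hnear i
    gcongr
  by_cases hrT : r < T
  · exfalso
    apply hX
    refine ⟨r, hXr, s, fun i => (tri i).trans ?_⟩
    have h1 := hs i
    have hrT' : (r : ℝ) ≤ T := by exact_mod_cast hrT.le
    have h2 : r * (P.C1 * (Q : ℝ) ^ (-(1 + P.v i))) ≤ T * P.C1 * (Q : ℝ) ^ (-(1 + P.v i)) := by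
      rw [mul_assoc]; gcongr
    have h3 : (T : ℝ) ^ (-(P.τ * P.w i)) ≤ (r : ℝ) ^ (-(P.τ * P.w i)) :=
      Real.rpow_le_rpow_of_nonpos hr0 hrT' (by linarith [P.τw_pos i])
    linarith [L1 i]
  push Not at hrT
  by_cases hrb : (r : ℝ) ^ P.b ≤ Q
  · exfalso
    apply hT
    refine ⟨r, hrT, s, fun i => (tri i).trans ?_⟩
    have h1 := hs i
    have h2 : (r : ℝ) ^ (-(P.τ * P.w i)) ≤ (r : ℝ) ^ (-(P.b * P.v i)) :=
      Real.rpow_le_rpow_of_exponent_le hr1 (by linarith [P.bv_le i])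
    have h3 : (r : ℝ) ≤ (Q : ℝ) ^ P.b⁻¹ := by
      have := Real.rpow_le_rpow (by positivity) hrb (by positivity : 0 ≤ P.b⁻¹)
      rwa [← Real.rpow_mul hr0.le, mul_inv_cancel₀ hb0.ne', Real.rpow_one] at this
    have h4 : (Q : ℝ) ^ (-P.v i) ≤ (r : ℝ) ^ (-(P.b * P.v i)) := by
      rw [← mul_neg, Real.rpow_mul hr0.le]
      exact Real.rpow_le_rpow_of_nonpos (by positivity) hrb (by linarith [P.hv i])
    have h5 : r * (P.C1 * (Q : ℝ) ^ (-(1 + P.v i))) ≤ (Q : ℝ) ^ (-P.v i) := by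
      calc r * (P.C1 * (Q : ℝ) ^ (-(1 + P.v i))) ≤ (Q : ℝ) ^ P.b⁻¹ * (P.C1 * (Q : ℝ) ^ (-(1 + P.v i))) := by
            gcongr
        _ = (P.C1 * (Q : ℝ) ^ (P.b⁻¹ - 1)) * (Q : ℝ) ^ (-P.v i) := by
            rw [mul_assoc, ← Real.rpow_add hQ, mul_left_comm, ← Real.rpow_add hQ]
            ring_nf
        _ ≤ 1 * (Q : ℝ) ^ (-P.v i) := by gcongr
        _ = _ := one_mul _
    linarith
  · push Not at hrb
    rcases h.all r s with hm | ⟨i, hi⟩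
    · exact hm
    · exfalso
      have h1 := hs i
      have h2 := P.outer_abs h.2.2.1 hε0 hε hx' i
      have h3 := h.g_le i
      have h4 : |(r : ℝ) * (p i / q) - s i| ≤ |(r : ℝ) * x' i - s i| + r * |x' i - p i / q| := by
        have e : (r : ℝ) * (p i / q) - s i = (r * x' i - s i) - r * (x' i - p i / q) := by ring
        rw [e]
        refine (abs_sub _ _).trans ?_
        rw [abs_mul (r : ℝ), abs_of_pos hr0]
      have h5 : r * |x' i - p i / q| ≤ P.κ / 2 * (Q : ℝ) ^ (-P.v i) := by
        have hc := P.c_pos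
        calc r * |x' i - p i / q| ≤ (Q : ℝ) ^ (1 + P.δ) *
              (P.c ^ (-(1 + P.τ)) * (Q : ℝ) ^ (-(1 + P.τ * P.w i))) := by
              gcongr
              exact h2.trans h3
          _ = P.c ^ (-(1 + P.τ)) * (Q : ℝ) ^ (P.δ - P.τ * P.w i) := by
              rw [mul_left_comm, ← Real.rpow_add hQ]
              ring_nf
          _ ≤ P.c ^ (-(1 + P.τ)) * (Q : ℝ) ^ (-(P.b * P.v i)) := by
              gcongr ?_ * ?_
              apply Real.rpow_le_rpow_of_exponent_le h.Q_one_le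
              have := P.hδv i
              have := P.hvb i
              linarith
          _ ≤ _ := L3 i
      have h6 : (r : ℝ) ^ (-(P.τ * P.w i)) ≤ (Q : ℝ) ^ (-(P.b * P.v i)) := by
        calc (r : ℝ) ^ (-(P.τ * P.w i)) ≤ (r : ℝ) ^ (P.b * (-(P.b * P.v i))) := by
              apply Real.rpow_le_rpow_of_exponent_le hr1
              have := P.hvb i
              nlinarith
          _ = ((r : ℝ) ^ P.b) ^ (-(P.b * P.v i)) := Real.rpow_mul hr0.le _ _
          _ ≤ _ := Real.rpow_le_rpow_of_nonpos hQ hrb.le (by have := P.hv i; nlinarith)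
      have := L4 i
      linarith

/-- constant in the lower bound for the number of children -/
noncomputable def c0 : ℝ := (1 / 2) * (P.c / 4) ^ d

theorem c0_pos : 0 < P.c0 := by
  unfold c0; have := P.c_pos; positivity

/-- what a child set has to satisfy -/
structure Child (p : Fin d → ℤ) (q : ℕ) (ε X ε' : ℝ) (Q : ℕ) (ch : Finset ((Fin d → ℤ) × ℕ)) : Prop where
  good : ∀ z ∈ ch, P.Good Q z.1 z.2
  sub : ∀ z ∈ ch, P.outer z.1 z.2 ε' ⊆ P.outer p q ε
  noap : ∀ z ∈ ch, ∀ x ∈ P.outer z.1 z.2 ε', ∀ r : ℕ, X ≤ r → (r : ℝ) ≤ (Q : ℝ) ^ (1 + P.δ) →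
    ∀ s : Fin d → ℤ, (∀ i, |(r : ℝ) * x i - s i| < (r : ℝ) ^ (-(P.τ * P.w i))) →
    ∃ m : ℕ, r = m * z.2 ∧ ∀ i, s i = m * z.1 i
  px : ∀ z ∈ ch, P.PX z.1 z.2 ε' ((Q : ℝ) ^ (1 + P.δ))
  card : P.c0 * (∏ i, (ε * P.g q i)) * (Q : ℝ) ^ ((d : ℝ) + 1) ≤ ch.card

theorem step (p : Fin d → ℤ) (q : ℕ) (hq : 0 < q) (ε : ℝ) (hε0 : 0 < ε) (hε : ε ≤ 1 / 8) (X : ℝ)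
    (hX : P.PX p q ε X) (ε' : ℝ) (hε'0 : 0 < ε') (hε' : ε' ≤ 1 / 8) :
    ∀ᶠ Q : ℕ in atTop, ∃ ch, P.Child p q ε X ε' Q ch := by
  have hgp : ∀ i, 0 < P.g q i := P.g_pos hq
  have hl : ∀ i, 0 < ε * P.g q i := fun i => mul_pos hε0 (hgp i)
  have hV : 0 < ∏ i, (ε * P.g q i) := Finset.prod_pos fun i _ => hl i
  have hc := P.c_pos
  have hκ := P.κ_pos
  have hb := P.hb
  have hC1 := P.C1_pos
  obtain ⟨T, hTv, hT1⟩ := ((vol_tail (P.a0 p q ε) (fun i => ε * P.g q i) (fun i => P.b * P.v i)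
    (fun i => (hl i).le) (fun i => mul_pos (by linarith) (P.hv i))
    (by rw [← Finset.mul_sum, P.hvsum]; linarith)
    ((∏ i, (ε * P.g q i)) / 8) (by positivity)).and (eventually_ge_atTop 1)).exists
  have hT0 : (0 : ℝ) < T := by exact_mod_cast hT1
  have S1 := vol_short (P.a0 p q ε) (fun i => ε * P.g q i) P.v hl P.hv P.hvsum (1 / 64) 1
    (by norm_num) (by norm_num) (by
      rw [mul_one, show (4 : ℝ) * (1 / 64) = 1 / 16 by norm_num]
      exact pow_le_of_le_one (by norm_num) (by norm_num) P.hd.ne')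
  have S2 := vol_short (P.a0 p q ε) (fun i => ε * P.g q i) P.v hl P.hv P.hvsum 2 P.c
    (by norm_num) hc (by
      unfold c
      rw [show (4 : ℝ) * 2 = 8 by norm_num]
      apply le_of_eq
      field_simp)
  have E1 : ∀ᶠ Q : ℕ in atTop, ∀ i, T * P.C1 * (Q : ℝ) ^ (-(1 + P.v i)) ≤ (T : ℝ) ^ (-(P.τ * P.w i)) := by
    rw [eventually_all]
    intro i
    have := ev_rpow (T * P.C1 / (T : ℝ) ^ (-(P.τ * P.w i))) 0 (1 + P.v i) (by linarith [P.hv i])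
    filter_upwards [this] with Q hQ
    rw [neg_zero, Real.rpow_zero, div_mul_eq_mul_div, div_le_one (by positivity)] at hQ
    exact hQ
  have E2 : ∀ᶠ Q : ℕ in atTop, P.C1 * (Q : ℝ) ^ (P.b⁻¹ - 1) ≤ 1 := by
    have := ev_rpow P.C1 0 (1 - P.b⁻¹) (by have := inv_lt_one_of_one_lt₀ hb; linarith)
    filter_upwards [this] with Q hQ
    rw [neg_zero, Real.rpow_zero, neg_sub] at hQ
    exact hQ
  have E3 : ∀ᶠ Q : ℕ in atTop, ∀ i, P.c ^ (-(1 + P.τ)) * (Q : ℝ) ^ (-(P.b * P.v i)) ≤ P.κ / 2 * (Q : ℝ) ^ (-P.v i) := by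
    rw [eventually_all]
    intro i
    have := ev_rpow (P.c ^ (-(1 + P.τ)) / (P.κ / 2)) (P.v i) (P.b * P.v i) (by nlinarith [P.hv i])
    filter_upwards [this] with Q hQ
    rw [div_mul_eq_mul_div, div_le_iff₀ (by positivity)] at hQ
    linarith
  have E4 : ∀ᶠ Q : ℕ in atTop, ∀ i, (Q : ℝ) ^ (-(P.b * P.v i)) ≤ P.κ / 2 * (Q : ℝ) ^ (-P.v i) := by
    rw [eventually_all]
    intro i
    have := ev_rpow (1 / (P.κ / 2)) (P.v i) (P.b * P.v i) (by nlinarith [P.hv i])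
    filter_upwards [this] with Q hQ
    rw [div_mul_eq_mul_div, div_le_iff₀ (by positivity)] at hQ
    linarith
  have E5 : ∀ᶠ Q : ℕ in atTop, ∀ i, P.C1 * (Q : ℝ) ^ (-(1 + P.v i)) ≤ ε * P.g q i := by
    rw [eventually_all]
    intro i
    have := hl i
    have := ev_rpow (P.C1 / (ε * P.g q i)) 0 (1 + P.v i) (by linarith [P.hv i])
    filter_upwards [this] with Q hQ
    rw [neg_zero, Real.rpow_zero, div_mul_eq_mul_div, div_le_one (hl i)] at hQ
    exact hQ
  filter_upwards [S1, S2, E1, E2, E3, E4, E5, P.PX_of_good ε' hε'0 hε', eventually_ge_atTop 1] with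
    Q s1 s2 e1 e2 e3 e4 e5 hpx hQ1
  have hQ0 : (0 : ℝ) < Q := by exact_mod_cast hQ1
  have hQ1' : (1 : ℝ) ≤ Q := by exact_mod_cast hQ1
  set B1 := {x : Fin d → ℝ | (∀ i, x i ∈ Icc (P.a0 p q ε i) (P.a0 p q ε i + ε * P.g q i)) ∧
      ∃ r : ℕ, X ≤ r ∧ ∃ s : Fin d → ℤ, ∀ i,
        |(r : ℝ) * x i - s i| ≤ 2 * (r : ℝ) ^ (-(P.τ * P.w i))} with hB1
  set B2 := {x : Fin d → ℝ | (∀ i, x i ∈ Icc (P.a0 p q ε i) (P.a0 p q ε i + ε * P.g q i)) ∧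
      ∃ r : ℕ, T ≤ r ∧ ∃ s : Fin d → ℤ, ∀ i,
        |(r : ℝ) * x i - s i| ≤ 2 * (r : ℝ) ^ (-(P.b * P.v i))} with hB2
  set B3 := {x : Fin d → ℝ | (∀ i, x i ∈ Icc (P.a0 p q ε i) (P.a0 p q ε i + ε * P.g q i)) ∧
      ∃ r : ℕ, 1 ≤ r ∧ (r : ℝ) ≤ 1 * Q ∧ ∃ s : Fin d → ℤ, ∀ i,
        |(r : ℝ) * x i - s i| ≤ (1 / 64) * (Q : ℝ) ^ (-P.v i)} with hB3
  set B4 := {x : Fin d → ℝ | (∀ i, x i ∈ Icc (P.a0 p q ε i) (P.a0 p q ε i + ε * P.g q i)) ∧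
      ∃ r : ℕ, 1 ≤ r ∧ (r : ℝ) ≤ P.c * Q ∧ ∃ s : Fin d → ℤ, ∀ i,
        |(r : ℝ) * x i - s i| ≤ 2 * (Q : ℝ) ^ (-P.v i)} with hB4
  set G := P.inner p q ε \ (B1 ∪ B2 ∪ B3 ∪ B4) with hG
  set Z : Set ((Fin d → ℤ) × ℕ) := {z | P.Good Q z.1 z.2 ∧ ∃ x ∈ G, ∀ i,
    |(z.2 : ℝ) * x i - z.1 i| ≤ 2 * (Q : ℝ) ^ (-P.v i)} with hZ
  obtain ⟨F, hF, -⟩ := card_sep Z (fun z i => (z.1 i : ℝ) / z.2)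
    (fun i => P.a0 p q ε i - 2 / P.c * (Q : ℝ) ^ (-(1 + P.v i)))
    (fun i => ε * P.g q i + 2 * (2 / P.c * (Q : ℝ) ^ (-(1 + P.v i))))
    (fun i => P.κ * (Q : ℝ) ^ (-(1 + P.v i))) (fun i => by positivity)
    (fun i => by have := hl i; positivity)
    (by
      rintro z ⟨hz, x, hxG, hx⟩ i
      have h1 := abs_le.1 (hz.near0 (hx i))
      have h2 := hxG.1 i
      constructor
      · linarith [h1.2, h2.1]
      · linarith [h1.1, h2.2])
    (by
      rintro z ⟨hz, -⟩ z' ⟨hz', -⟩ hne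
      exact hz.sep hz' hne)
  have hmemF : ∀ z, z ∈ F → z ∈ Z := fun z hz => by rw [← hF]; exact hz
  refine ⟨F, ⟨fun z hz => (hmemF z hz).1, ?_, ?_, fun z hz => hpx _ _ (hmemF z hz).1, ?_⟩⟩
  · intro z hz x' hx' i
    obtain ⟨hg, x, hxG, hx⟩ := hmemF z hz
    have h1 := abs_le.1 (hg.near hx hε'0 hε' hx' i)
    have h2 := hxG.1 i
    have h3 := e5 i
    unfold a0 at h2
    constructor
    · linarith [h2.1, h1.2]
    · linarith [h2.2, h1.1]
  · intro z hz x' hx' r hXr hrQ s hs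
    obtain ⟨hg, x, hxG, hx⟩ := hmemF z hz
    have hin := hxG.1
    have hnot := hxG.2
    simp only [mem_union, not_or] at hnot
    obtain ⟨⟨⟨n1, n2⟩, n3⟩, n4⟩ := hnot
    exact noapprox hg hx hε'0 hε' hx' X T hT1 (fun hh => n1 ⟨hin, hh⟩) (fun hh => n2 ⟨hin, hh⟩)
      e1 e2 e3 e4 r hXr hrQ s hs
  · have hcov : P.inner p q ε ⊆ (B1 ∪ B2 ∪ B3 ∪ B4) ∪ ⋃ z ∈ F, {x : Fin d → ℝ | ∀ i, x i ∈
        Icc ((z.1 i : ℝ) / z.2 - 2 / P.c * (Q : ℝ) ^ (-(1 + P.v i)))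
          ((z.1 i : ℝ) / z.2 + 2 / P.c * (Q : ℝ) ^ (-(1 + P.v i)))} := by
      intro x hx
      by_cases hxB : x ∈ B1 ∪ B2 ∪ B3 ∪ B4
      · exact Or.inl hxB
      · right
        have hnot := hxB
        simp only [mem_union, not_or] at hnot
        obtain ⟨⟨⟨n1, n2⟩, n3⟩, n4⟩ := hnot
        obtain ⟨p', q', hg, hpq⟩ := P.good_of_short x Q hQ1 (fun hh => n3 ⟨hx, hh⟩)
          (fun hh => n4 ⟨hx, hh⟩)
        simp only [mem_iUnion]
        refine ⟨(p', q'), ?_, ?_⟩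
        · rw [← Finset.mem_coe, hF]
          exact ⟨hg, x, ⟨hx, hxB⟩, hpq⟩
        · intro i
          have := abs_le.1 (hg.near0 (hpq i))
          constructor
          · simp only; linarith [this.1]
          · simp only; linarith [this.2]
    have hbox : ∀ z ∈ F, volume {x : Fin d → ℝ | ∀ i, x i ∈
        Icc ((z.1 i : ℝ) / z.2 - 2 / P.c * (Q : ℝ) ^ (-(1 + P.v i)))
          ((z.1 i : ℝ) / z.2 + 2 / P.c * (Q : ℝ) ^ (-(1 + P.v i)))} =
        ENNReal.ofReal ((4 / P.c) ^ d * (Q : ℝ) ^ (-((d : ℝ) + 1))) := by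
      intro z _
      rw [vol_cbox, ← ENNReal.ofReal_prod_of_nonneg (fun i _ => by
        rw [add_sub_sub_cancel]; positivity)]
      congr 1
      have e : ∀ i, (z.1 i : ℝ) / z.2 + 2 / P.c * (Q : ℝ) ^ (-(1 + P.v i)) -
          ((z.1 i : ℝ) / z.2 - 2 / P.c * (Q : ℝ) ^ (-(1 + P.v i))) = 4 / P.c * (Q : ℝ) ^ (-(1 + P.v i)) := by
        intro i; ring
      rw [Finset.prod_congr rfl (fun i _ => e i), Finset.prod_mul_distrib, ← Real.rpow_sum_of_pos hQ0,
        Finset.sum_neg_distrib, Finset.sum_add_distrib, P.hvsum]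
      simp [div_pow]
    have hinner : volume (P.inner p q ε) = ENNReal.ofReal (∏ i, (ε * P.g q i)) := by
      unfold inner
      rw [vol_cbox, ← ENNReal.ofReal_prod_of_nonneg (fun i _ => by
        rw [add_sub_cancel_left]; exact (hl i).le)]
      congr 1
      exact Finset.prod_congr rfl (fun i _ => by ring)
    have hfin : ENNReal.ofReal (∏ i, (ε * P.g q i)) ≤ ENNReal.ofReal ((∏ i, (ε * P.g q i)) / 8
        + (∏ i, (ε * P.g q i)) / 8 + (∏ i, (ε * P.g q i)) / 8 + (∏ i, (ε * P.g q i)) / 8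
        + F.card * ((4 / P.c) ^ d * (Q : ℝ) ^ (-((d : ℝ) + 1)))) := by
      rw [← hinner]
      refine (measure_mono hcov).trans ((measure_union_le _ _).trans ?_)
      rw [ENNReal.ofReal_add (by positivity) (by positivity), ENNReal.ofReal_add (by positivity) (by positivity),
        ENNReal.ofReal_add (by positivity) (by positivity), ENNReal.ofReal_add (by positivity) (by positivity)]
      refine add_le_add ((measure_union_le _ _).trans (add_le_add ((measure_union_le _ _).trans
        (add_le_add ((measure_union_le _ _).trans (add_le_add hX hTv)) s1)) s2)) ?_
      refine (measure_biUnion_finset_le _ _).trans ((Finset.sum_le_sum fun z hz => (hbox z hz).le).trans ?_)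
      rw [Finset.sum_const, nsmul_eq_mul, ← ENNReal.ofReal_natCast, ← ENNReal.ofReal_mul (by positivity)]
    rw [ENNReal.ofReal_le_ofReal_iff (by positivity)] at hfin
    have h1 : (∏ i, (ε * P.g q i)) / 2 ≤ F.card * ((4 / P.c) ^ d * (Q : ℝ) ^ (-((d : ℝ) + 1))) := by linarith
    unfold c0
    have h2 : (1 / 2 * (P.c / 4) ^ d) * (∏ i, (ε * P.g q i)) * (Q : ℝ) ^ ((d : ℝ) + 1) =
        ((∏ i, (ε * P.g q i)) / 2) * ((P.c / 4) ^ d * (Q : ℝ) ^ ((d : ℝ) + 1)) := by ring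
    rw [h2]
    refine (mul_le_mul_of_nonneg_right h1 (by positivity)).trans (le_of_eq ?_)
    rw [Real.rpow_neg hQ0.le, div_pow, div_pow]
    field_simp

end Par

open Real MeasureTheory Set Filter Topology

/-- Parameters of the construction together with the exponents of the mass distribution. -/
structure Par2 (d : ℕ) extends Par d where
  η : ℝ
  σ : ℝ
  s : ℝ
  hη : 0 < η
  hσ : 0 < σ
  hs : 0 < s
  hexp : ∀ Q r : ℝ, 1 ≤ Q → 0 < r → r ≤ Q⁻¹ →
    Q ^ (η + σ - ((d : ℝ) + 1)) * ∏ i, (max 1 (r * Q ^ (1 + v i)) * min 1 (r * Q ^ (1 + τ * w i))) ≤ r ^ s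

noncomputable def eps (k : ℕ) : ℝ := 1 / ((k : ℝ) + 8)
theorem eps_pos (k : ℕ) : 0 < eps k := by unfold eps; positivity
theorem eps_le (k : ℕ) : eps k ≤ 1 / 8 := by
  unfold eps
  apply one_div_le_one_div_of_le (by norm_num)
  have : (0 : ℝ) ≤ k := by positivity
  linarith

/-- one level of the Cantor construction -/
structure Lev (d : ℕ) where
  F : Finset ((Fin d → ℤ) × ℕ)
  Q : ℕ
  X : ℝ
  m : (Fin d → ℤ) × ℕ → ℝ

namespace Par2
variable {d : ℕ} (P : Par2 d)

structure Inv (k : ℕ) (A : Lev d) : Prop where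
  good : ∀ z ∈ A.F, P.Good A.Q z.1 z.2
  px : ∀ z ∈ A.F, P.PX z.1 z.2 (eps k) A.X
  m0 : ∀ z, 0 ≤ A.m z
  msum : ∑ z ∈ A.F, A.m z = 1
  mle : ∀ z ∈ A.F, A.m z ≤ (A.Q : ℝ) ^ (P.η - ((d : ℝ) + 1))
  size : ((k : ℝ) + 8) ^ d ≤ 8 ^ d * (A.Q : ℝ) ^ P.σ
  Qpos : 0 < A.Q

structure Next (k : ℕ) (A B : Lev d) (ch : (Fin d → ℤ) × ℕ → Finset ((Fin d → ℤ) × ℕ)) : Prop where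
  child : ∀ z ∈ A.F, P.Child z.1 z.2 (eps k) A.X (eps (k + 1)) B.Q (ch z)
  hF : ∀ z', z' ∈ B.F ↔ ∃ z ∈ A.F, z' ∈ ch z
  hX : B.X = (B.Q : ℝ) ^ (1 + P.δ)
  hm : ∀ z', B.m z' = ∑ z ∈ A.F, if z' ∈ ch z then A.m z / (ch z).card else 0
  hg : ∀ z ∈ A.F, ∀ i, 1 ≤ (B.Q : ℝ) * P.g z.2 i
  hQ : A.Q < B.Q

variable {P}

theorem Next.sum {k : ℕ} {A B : Lev d} {ch : (Fin d → ℤ) × ℕ → Finset ((Fin d → ℤ) × ℕ)}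
    (h : P.Next k A B ch) (f : (Fin d → ℤ) × ℕ → ℝ) :
    ∑ z' ∈ B.F, B.m z' * f z' = ∑ z ∈ A.F, A.m z / (ch z).card * ∑ z' ∈ ch z, f z' := by
  classical
  simp_rw [h.hm, Finset.sum_mul]
  rw [Finset.sum_comm]
  apply Finset.sum_congr rfl
  intro z hz
  rw [Finset.mul_sum]
  have hsub : ch z ⊆ B.F := fun z' hz' => (h.hF z').2 ⟨z, hz, hz'⟩
  rw [← Finset.sum_subset hsub]
  · apply Finset.sum_congr rfl
    intro z' hz'
    rw [if_pos hz']
  · intro z' _ hz'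
    rw [if_neg hz', zero_mul]

theorem Inv.cz {k : ℕ} {A B : Lev d} {ch : (Fin d → ℤ) × ℕ → Finset ((Fin d → ℤ) × ℕ)}
    (hA : P.Inv k A) (h : P.Next k A B ch) {z} (hz : z ∈ A.F) : (0 : ℝ) < (ch z).card := by
  refine lt_of_lt_of_le ?_ (h.child z hz).card
  have h1 := P.c0_pos
  have h2 := eps_pos k
  have hB : (0 : ℝ) < B.Q := by exact_mod_cast lt_of_le_of_lt (Nat.zero_le _) h.hQ
  have h3 : 0 < ∏ i, (eps k * P.g z.2 i) :=
    Finset.prod_pos fun i _ => mul_pos h2 (P.g_pos (hA.good z hz).2.2.1 i)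
  positivity

theorem next_exists (k : ℕ) (A : Lev d) (hA : P.Inv k A) :
    ∃ B ch, P.Inv (k + 1) B ∧ P.Next k A B ch := by
  classical
  have hε := eps_pos k
  have hc0 := P.c0_pos
  have hgp : ∀ z ∈ A.F, ∀ i, 0 < P.g z.2 i := fun z hz i => P.g_pos (hA.good z hz).2.2.1 i
  have E1 : ∀ᶠ Q : ℕ in atTop, ∀ z ∈ A.F, ∃ ch, P.Child z.1 z.2 (eps k) A.X (eps (k + 1)) Q ch := by
    rw [Finset.eventually_all]
    intro z hz
    exact P.step z.1 z.2 (hA.good z hz).2.2.1 (eps k) (eps_pos k) (eps_le k) A.X (hA.px z hz)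
      (eps (k + 1)) (eps_pos _) (eps_le _)
  have E2 : ∀ᶠ Q : ℕ in atTop, ∀ z ∈ A.F, ∀ i, 1 ≤ (Q : ℝ) * P.g z.2 i := by
    rw [Finset.eventually_all]
    intro z hz
    rw [eventually_all]
    intro i
    have := hgp z hz i
    filter_upwards [tendsto_natCast_atTop_atTop.eventually_ge_atTop (1 / P.g z.2 i)] with Q hQ
    rwa [div_le_iff₀ this] at hQ
  have E3 : ∀ᶠ Q : ℕ in atTop, ∀ z ∈ A.F, 1 ≤ (Q : ℝ) ^ P.η * (P.c0 * ∏ i, (eps k * P.g z.2 i)) := by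
    rw [Finset.eventually_all]
    intro z hz
    have h3 : 0 < P.c0 * ∏ i, (eps k * P.g z.2 i) :=
      mul_pos hc0 (Finset.prod_pos fun i _ => mul_pos hε (hgp z hz i))
    filter_upwards [((tendsto_rpow_atTop P.hη).comp tendsto_natCast_atTop_atTop).eventually_ge_atTop
      (1 / (P.c0 * ∏ i, (eps k * P.g z.2 i)))] with Q hQ
    rwa [div_le_iff₀ h3] at hQ
  have E4 : ∀ᶠ Q : ℕ in atTop, (((k + 1 : ℕ) : ℝ) + 8) ^ d ≤ 8 ^ d * (Q : ℝ) ^ P.σ := by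
    filter_upwards [((tendsto_rpow_atTop P.hσ).comp tendsto_natCast_atTop_atTop).eventually_ge_atTop
      ((((k + 1 : ℕ) : ℝ) + 8) ^ d / 8 ^ d)] with Q hQ
    rw [div_le_iff₀ (by positivity)] at hQ
    rw [mul_comm]
    exact hQ
  obtain ⟨Q, e1, e2, e3, e4, e5⟩ := (E1.and (E2.and (E3.and (E4.and (eventually_gt_atTop A.Q))))).exists
  choose! ch hch using e1
  have hQpos : 0 < Q := by omega
  have hQ0 : (0 : ℝ) < Q := by exact_mod_cast hQpos
  set B : Lev d := ⟨A.F.biUnion ch, Q, (Q : ℝ) ^ (1 + P.δ),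
    fun z' => ∑ z ∈ A.F, if z' ∈ ch z then A.m z / (ch z).card else 0⟩ with hB
  have hN : P.Next k A B ch := ⟨hch, fun z' => by simp [hB], rfl, fun z' => rfl, e2, e5⟩
  have hBF : ∀ z' ∈ B.F, ∃ z ∈ A.F, z' ∈ ch z := fun z' hz' => (hN.hF z').1 hz'
  refine ⟨B, ch, ⟨?_, ?_, ?_, ?_, ?_, e4, hQpos⟩, hN⟩
  · intro z' hz'
    obtain ⟨z, hz, hzz⟩ := hBF z' hz'
    exact (hch z hz).good z' hzz
  · intro z' hz'
    obtain ⟨z, hz, hzz⟩ := hBF z' hz'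
    exact (hch z hz).px z' hzz
  · intro z'
    apply Finset.sum_nonneg
    intro z _
    split_ifs
    · exact div_nonneg (hA.m0 z) (by positivity)
    · exact le_rfl
  · have := hN.sum (fun _ => 1)
    simp only [mul_one] at this
    refine this.trans (Eq.trans ?_ hA.msum)
    apply Finset.sum_congr rfl
    intro z hz
    have := hA.cz hN hz
    rw [Finset.sum_const, nsmul_eq_mul, mul_one]
    field_simp
  · intro z' hz'
    rw [hN.hm]
    calc (∑ z ∈ A.F, if z' ∈ ch z then A.m z / (ch z).card else 0) ≤
          ∑ z ∈ A.F, A.m z * (Q : ℝ) ^ (P.η - ((d : ℝ) + 1)) := by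
          apply Finset.sum_le_sum
          intro z hz
          have h0 := hA.m0 z
          split_ifs
          · rw [div_eq_mul_inv]
            apply mul_le_mul_of_nonneg_left _ h0
            have h1 := (hch z hz).card
            have h2 := e3 z hz
            have h3 : (Q : ℝ) ^ (P.η - ((d : ℝ) + 1)) = (Q : ℝ) ^ P.η * ((Q : ℝ) ^ ((d : ℝ) + 1))⁻¹ := by
              rw [Real.rpow_sub hQ0, div_eq_mul_inv]
            have h4 := hA.cz hN hz
            rw [h3, inv_le_iff_one_le_mul₀ h4]
            have h5 : 0 < (Q : ℝ) ^ ((d : ℝ) + 1) := by positivity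
            calc (1 : ℝ) ≤ (Q : ℝ) ^ P.η * (P.c0 * ∏ i, (eps k * P.g z.2 i)) := h2
              _ = (Q : ℝ) ^ P.η * ((Q : ℝ) ^ ((d : ℝ) + 1))⁻¹ *
                  (P.c0 * (∏ i, (eps k * P.g z.2 i)) * (Q : ℝ) ^ ((d : ℝ) + 1)) := by field_simp
              _ ≤ _ := by gcongr
          · positivity
      _ = _ := by rw [← Finset.sum_mul, hA.msum, one_mul]

variable (P)

theorem seq_exists : ∃ (f : ℕ → Lev d) (ch : ℕ → (Fin d → ℤ) × ℕ → Finset ((Fin d → ℤ) × ℕ)),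
    (f 0).F = {(0, 1)} ∧ (f 0).Q = 1 ∧ (∀ k, P.Inv k (f k)) ∧ ∀ k, P.Next k (f k) (f (k + 1)) (ch k) := by
  obtain ⟨X0, hX0⟩ := (P.PX_start (eps 0) (eps_pos 0) 0 1 one_pos).exists
  set A0 : Lev d := ⟨{(0, 1)}, 1, X0, fun _ => 1⟩ with hA0
  have h0 : P.Inv 0 A0 := by
    refine ⟨?_, ?_, ?_, ?_, ?_, ?_, one_pos⟩
    · intro z hz
      simp only [hA0, Finset.mem_singleton] at hz
      subst hz
      refine ⟨?_, le_rfl, one_pos, ?_⟩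
      · simp only [hA0, Nat.cast_one, mul_one]; exact P.c_le
      · intro r h1 h2; omega
    · intro z hz
      simp only [hA0, Finset.mem_singleton] at hz
      subst hz
      exact hX0
    · intro z; simp [hA0]
    · simp [hA0]
    · intro z _; simp [hA0]
    · simp [hA0]
  choose! nxt ch hn1 hn2 using fun (k : ℕ) (A : Lev d) (hA : P.Inv k A) => next_exists k A hA
  set f : (k : ℕ) → {A : Lev d // P.Inv k A} := fun k =>
    Nat.rec (motive := fun k => {A : Lev d // P.Inv k A}) ⟨A0, h0⟩
      (fun k A => ⟨nxt k A.1, hn1 k A.1 A.2⟩) k with hf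
  exact ⟨fun k => (f k).1, fun k => ch k (f k).1, rfl, rfl, fun k => (f k).2, fun k => hn2 k _ (f k).2⟩

open Classical in
/-- mass of boxes of level `k` meeting `U` -/
noncomputable def M (k : ℕ) (A : Lev d) (U : Set (Fin d → ℝ)) : ℝ :=
  ∑ z ∈ A.F, A.m z * (if (P.outer z.1 z.2 (eps k) ∩ U).Nonempty then 1 else 0)

variable {P}

open Classical in
theorem M_next {k : ℕ} {A B : Lev d} {ch : (Fin d → ℤ) × ℕ → Finset ((Fin d → ℤ) × ℕ)}
    (h : P.Next k A B ch) (U : Set (Fin d → ℝ)) :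
    P.M (k + 1) B U = ∑ z ∈ A.F, A.m z / (ch z).card *
      ((ch z).filter fun z' => (P.outer z'.1 z'.2 (eps (k + 1)) ∩ U).Nonempty).card := by
  unfold M
  rw [h.sum]
  apply Finset.sum_congr rfl
  intro z _
  congr 1
  rw [Finset.sum_boole]

theorem M_anti {k : ℕ} {A B : Lev d} {ch : (Fin d → ℤ) × ℕ → Finset ((Fin d → ℤ) × ℕ)}
    (hA : P.Inv k A) (h : P.Next k A B ch) (U : Set (Fin d → ℝ)) : P.M (k + 1) B U ≤ P.M k A U := by
  classical
  rw [M_next h]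
  unfold M
  apply Finset.sum_le_sum
  intro z hz
  have hc := hA.cz h hz
  have h0 := hA.m0 z
  split_ifs with hne
  · rw [div_mul_eq_mul_div, div_le_iff₀ hc, mul_one]
    gcongr
    exact Finset.filter_subset _ _
  · rw [Finset.filter_false_of_mem]
    · simp
    · intro z' hz' hne'
      exact hne (hne'.mono (inter_subset_inter_left _ ((h.child z hz).sub z' hz')))

/-- counting constant -/
noncomputable def Ca (P : Par2 d) : ℝ := 1 / P.κ + 2 * P.c ^ (-(1 + P.τ)) / P.κ + 1

theorem Ca_pos : 0 < P.Ca := by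
  unfold Ca
  have := P.c_pos
  have := P.κ_pos
  positivity

/-- counting good boxes meeting a rectangle -/
theorem count {Q : ℕ} (hQ : 0 < Q) (F : Finset ((Fin d → ℤ) × ℕ)) (hF : ∀ z ∈ F, P.Good Q z.1 z.2)
    {ε : ℝ} (hε0 : 0 < ε) (hε : ε ≤ 1 / 8) (a l : Fin d → ℝ) (hl : ∀ i, 0 ≤ l i)
    (hm : ∀ z ∈ F, ∃ x ∈ P.outer z.1 z.2 ε, ∀ i, x i ∈ Icc (a i) (a i + l i)) :
    (F.card : ℝ) ≤ ∏ i, (P.Ca * max 1 (l i * (Q : ℝ) ^ (1 + P.v i))) := by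
  have hc := P.c_pos
  have hκ := P.κ_pos
  have hQ0 : (0 : ℝ) < Q := by exact_mod_cast hQ
  set c' := P.c ^ (-(1 + P.τ)) with hc'
  have hc'0 : 0 < c' := by positivity
  obtain ⟨F', hF', hcard⟩ := card_sep (F : Set ((Fin d → ℤ) × ℕ)) (fun z i => (z.1 i : ℝ) / z.2)
    (fun i => a i - c' * (Q : ℝ) ^ (-(1 + P.v i))) (fun i => l i + 2 * (c' * (Q : ℝ) ^ (-(1 + P.v i))))
    (fun i => P.κ * (Q : ℝ) ^ (-(1 + P.v i))) (fun i => by positivity)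
    (fun i => by have := hl i; positivity)
    (by
      intro z hz i
      have hg := hF z hz
      obtain ⟨x, hx, hxi⟩ := hm z hz
      have h1 := P.outer_abs hg.2.2.1 hε0 hε hx i
      have h2 := hg.g_le i
      have h4 : (Q : ℝ) ^ (-(1 + P.τ * P.w i)) ≤ (Q : ℝ) ^ (-(1 + P.v i)) :=
        Real.rpow_le_rpow_of_exponent_le hg.Q_one_le (by linarith [P.v_le_τw i])
      have h5 := abs_le.1 (h1.trans (h2.trans (mul_le_mul_of_nonneg_left h4 hc'0.le)))
      have h6 := hxi i
      constructor
      · linarith [h5.2, h6.1]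
      · linarith [h5.1, h6.2])
    (by
      intro z hz z' hz' hne
      exact (hF z hz).sep (hF z' hz') hne)
  have : F' = F := by exact_mod_cast hF'
  rw [this] at hcard
  refine hcard.trans (Finset.prod_le_prod (fun i _ => by have := hl i; positivity) ?_)
  intro i _
  have hpos : 0 < (Q : ℝ) ^ (1 + P.v i) := by positivity
  have e : (l i + 2 * (c' * (Q : ℝ) ^ (-(1 + P.v i)))) / (P.κ * (Q : ℝ) ^ (-(1 + P.v i))) + 1 =
      1 / P.κ * (l i * (Q : ℝ) ^ (1 + P.v i)) + (2 * c' / P.κ + 1) * 1 := by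
    rw [Real.rpow_neg hQ0.le]
    field_simp
    ring
  rw [e]
  unfold Ca
  rw [← hc']
  have h1 : l i * (Q : ℝ) ^ (1 + P.v i) ≤ max 1 (l i * (Q : ℝ) ^ (1 + P.v i)) := le_max_right _ _
  have h2 : 1 ≤ max 1 (l i * (Q : ℝ) ^ (1 + P.v i)) := le_max_left _ _
  have h3 : 0 < 1 / P.κ := by positivity
  have h4 : 0 < 2 * c' / P.κ + 1 := by positivity
  calc _ ≤ 1 / P.κ * (max 1 (l i * (Q : ℝ) ^ (1 + P.v i))) + (2 * c' / P.κ + 1) *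
        (max 1 (l i * (Q : ℝ) ^ (1 + P.v i))) := by gcongr
    _ = _ := by ring

/-- constant in the mass bound -/
noncomputable def Cm (P : Par2 d) : ℝ := P.Ca ^ d * P.Ca ^ d / P.c0 * 8 ^ d

theorem Cm_pos : 0 < P.Cm := by
  unfold Cm
  have := P.c0_pos
  have := Ca_pos (P := P)
  positivity

theorem M_key {k : ℕ} {A B : Lev d} {ch : (Fin d → ℤ) × ℕ → Finset ((Fin d → ℤ) × ℕ)}
    (hA : P.Inv k A) (h : P.Next k A B ch) (U : Set (Fin d → ℝ)) (a : Fin d → ℝ) (r : ℝ) (hr0 : 0 < r)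
    (hU : ∀ x ∈ U, ∀ i, x i ∈ Icc (a i) (a i + r)) (hr1 : (B.Q : ℝ)⁻¹ ≤ r) (hr2 : r ≤ (A.Q : ℝ)⁻¹) :
    P.M (k + 1) B U ≤ P.Cm * r ^ P.s := by
  classical
  have hc0 := P.c0_pos
  have hCa := Ca_pos (P := P)
  have hε := eps_pos k
  have hAQ : (0 : ℝ) < A.Q := by exact_mod_cast hA.Qpos
  have hAQ1 : (1 : ℝ) ≤ A.Q := by exact_mod_cast hA.Qpos
  have hBQn : 0 < B.Q := lt_of_le_of_lt (Nat.zero_le _) h.hQ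
  have hBQ : (0 : ℝ) < B.Q := by exact_mod_cast hBQn
  have hBQ1 : (1 : ℝ) ≤ B.Q := by exact_mod_cast hBQn
  have hBr : 1 ≤ r * B.Q := by rwa [inv_le_iff_one_le_mul₀ hBQ] at hr1
  set q : ℝ := (A.Q : ℝ) with hq
  set R : ℝ := P.Ca ^ d / (P.c0 * eps k ^ d) * ∏ i, min 1 (r * q ^ (1 + P.τ * P.w i)) with hR
  have hR0 : 0 ≤ R := by
    have : 0 ≤ ∏ i, min 1 (r * q ^ (1 + P.τ * P.w i)) := Finset.prod_nonneg fun i _ => by positivity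
    positivity
  -- children of a box
  have h1 : ∀ z ∈ A.F, A.m z / (ch z).card *
      ((ch z).filter fun z' => (P.outer z'.1 z'.2 (eps (k + 1)) ∩ U).Nonempty).card ≤
      if (P.outer z.1 z.2 (eps k) ∩ U).Nonempty then q ^ (P.η - ((d : ℝ) + 1)) * R else 0 := by
    intro z hz
    split_ifs with hne
    · have hgp : ∀ i, 0 < P.g z.2 i := P.g_pos (hA.good z hz).2.2.1
      have hcz := hA.cz h hz
      have hcount := count (P := P) hBQn
        ((ch z).filter fun z' => (P.outer z'.1 z'.2 (eps (k + 1)) ∩ U).Nonempty)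
        (fun z' hz' => (h.child z hz).good z' (Finset.mem_filter.1 hz').1)
        (eps_pos (k + 1)) (eps_le (k + 1))
        (fun i => if r ≤ P.g z.2 i then a i else (z.1 i : ℝ) / z.2 + (1 - 4 * eps k) * P.g z.2 i)
        (fun i => min r (P.g z.2 i)) (fun i => le_min hr0.le (hgp i).le)
        (by
          intro z' hz'
          obtain ⟨hz'1, x, hx, hxU⟩ := Finset.mem_filter.1 hz'
          refine ⟨x, hx, fun i => ?_⟩
          have hx2 := (h.child z hz).sub z' hz'1 hx i
          have hx3 := hU x hxU i
          have := eps_le k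
          by_cases hri : r ≤ P.g z.2 i
          · simp only [if_pos hri, min_eq_left hri]
            exact hx3
          · have hri' := le_of_not_ge hri
            simp only [if_neg hri, min_eq_right hri']
            have := hgp i
            constructor
            · exact hx2.1
            · nlinarith [hx2.2])
      have hcount2 : (((ch z).filter fun z' => (P.outer z'.1 z'.2 (eps (k + 1)) ∩ U).Nonempty).card : ℝ) ≤
          P.Ca ^ d * (∏ i, min r (P.g z.2 i)) * (B.Q : ℝ) ^ ((d : ℝ) + 1) := by
        refine hcount.trans (le_of_eq ?_)
        have e : ∀ i, max 1 (min r (P.g z.2 i) * (B.Q : ℝ) ^ (1 + P.v i)) =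
            min r (P.g z.2 i) * (B.Q : ℝ) ^ (1 + P.v i) := by
          intro i
          apply max_eq_right
          have t1 : 1 ≤ min r (P.g z.2 i) * B.Q := by
            rw [min_mul_of_nonneg _ _ hBQ.le, le_min_iff]
            exact ⟨hBr, by rw [mul_comm]; exact h.hg z hz i⟩
          have t2 : (B.Q : ℝ) ≤ (B.Q : ℝ) ^ (1 + P.v i) := by
            conv_lhs => rw [← Real.rpow_one (B.Q : ℝ)]
            exact Real.rpow_le_rpow_of_exponent_le hBQ1 (by linarith [P.hv i])
          have t3 : 0 ≤ min r (P.g z.2 i) := le_min hr0.le (hgp i).le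
          exact t1.trans (mul_le_mul_of_nonneg_left t2 t3)
        rw [Finset.prod_congr rfl (fun i _ => by rw [e i]), Finset.prod_mul_distrib, Finset.prod_mul_distrib,
          ← Real.rpow_sum_of_pos hBQ, Finset.sum_add_distrib, P.hvsum]
        simp [mul_assoc]
      have hratio : (((ch z).filter fun z' => (P.outer z'.1 z'.2 (eps (k + 1)) ∩ U).Nonempty).card : ℝ) ≤
          R * (ch z).card := by
        have hG : 0 < ∏ i, P.g z.2 i := Finset.prod_pos fun i _ => hgp i
        have hmin : ∏ i, min r (P.g z.2 i) ≤ (∏ i, min 1 (r * q ^ (1 + P.τ * P.w i))) * ∏ i, P.g z.2 i := by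
          rw [← Finset.prod_mul_distrib]
          apply Finset.prod_le_prod
          · intro i _; exact le_min hr0.le (hgp i).le
          · intro i _
            rw [min_mul_of_nonneg _ _ (hgp i).le, one_mul, min_comm]
            apply min_le_min le_rfl
            have hz0 : (0 : ℝ) < z.2 := (hA.good z hz).qpos
            have t : q ^ (-(1 + P.τ * P.w i)) ≤ P.g z.2 i :=
              Real.rpow_le_rpow_of_nonpos hz0 (hA.good z hz).qle (by linarith [P.τw_pos i])
            calc r = r * q ^ (1 + P.τ * P.w i) * q ^ (-(1 + P.τ * P.w i)) := by
                  rw [mul_assoc, ← Real.rpow_add hAQ, add_neg_cancel, Real.rpow_zero, mul_one]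
              _ ≤ _ := by gcongr
        calc _ ≤ P.Ca ^ d * (∏ i, min r (P.g z.2 i)) * (B.Q : ℝ) ^ ((d : ℝ) + 1) := hcount2
          _ ≤ P.Ca ^ d * ((∏ i, min 1 (r * q ^ (1 + P.τ * P.w i))) * ∏ i, P.g z.2 i) *
              (B.Q : ℝ) ^ ((d : ℝ) + 1) := by gcongr
          _ = R * (P.c0 * (∏ i, (eps k * P.g z.2 i)) * (B.Q : ℝ) ^ ((d : ℝ) + 1)) := by
              rw [hR, Finset.prod_mul_distrib]
              simp only [Finset.prod_const, Finset.card_univ, Fintype.card_fin]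
              field_simp
          _ ≤ _ := by
              gcongr
              exact (h.child z hz).card
      calc _ ≤ A.m z / (ch z).card * (R * (ch z).card) := by
            apply mul_le_mul_of_nonneg_left hratio
            exact div_nonneg (hA.m0 z) hcz.le
        _ = A.m z * R := by field_simp
        _ ≤ _ := mul_le_mul_of_nonneg_right (hA.mle z hz) hR0
    · rw [Finset.filter_false_of_mem]
      · simp
      · intro z' hz' hne'
        exact hne (hne'.mono (inter_subset_inter_left _ ((h.child z hz).sub z' hz')))
  rw [M_next h]
  refine (Finset.sum_le_sum h1).trans ?_
  rw [← Finset.sum_filter, Finset.sum_const, nsmul_eq_mul]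
  have hcount := count (P := P) hA.Qpos
    (A.F.filter fun z => (P.outer z.1 z.2 (eps k) ∩ U).Nonempty)
    (fun z hz => hA.good z (Finset.mem_filter.1 hz).1) (eps_pos k) (eps_le k) a (fun _ => r)
    (fun _ => hr0.le)
    (by
      intro z hz
      obtain ⟨hz1, x, hx, hxU⟩ := Finset.mem_filter.1 hz
      exact ⟨x, hx, hU x hxU⟩)
  rw [Finset.prod_mul_distrib] at hcount
  simp only [Finset.prod_const, Finset.card_univ, Fintype.card_fin] at hcount
  have hexp := P.hexp q r hAQ1 hr0 hr2
  rw [Finset.prod_mul_distrib] at hexp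
  have hsize := hA.size
  have hεk : eps k = ((k : ℝ) + 8)⁻¹ := by unfold eps; rw [one_div]
  set Y1 := ∏ i, max 1 (r * q ^ (1 + P.v i)) with hY1
  set Y2 := ∏ i, min 1 (r * q ^ (1 + P.τ * P.w i)) with hY2
  have hY1' : 0 ≤ Y1 := Finset.prod_nonneg fun i _ => by positivity
  have hY2' : 0 ≤ Y2 := Finset.prod_nonneg fun i _ => by positivity
  have hk8 : (0 : ℝ) < ((k : ℝ) + 8) ^ d := by positivity
  calc _ ≤ (P.Ca ^ d * Y1) * (q ^ (P.η - ((d : ℝ) + 1)) * R) := by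
        gcongr
    _ = P.Ca ^ d * P.Ca ^ d / P.c0 * ((k : ℝ) + 8) ^ d * (q ^ (P.η - ((d : ℝ) + 1)) * (Y1 * Y2)) := by
        rw [hR, hεk, inv_pow]
        field_simp
    _ ≤ P.Ca ^ d * P.Ca ^ d / P.c0 * (8 ^ d * q ^ P.σ) * (q ^ (P.η - ((d : ℝ) + 1)) * (Y1 * Y2)) := by
        gcongr
    _ = P.Cm * (q ^ (P.η + P.σ - ((d : ℝ) + 1)) * (Y1 * Y2)) := by
        unfold Cm
        rw [show P.η + P.σ - ((d : ℝ) + 1) = P.σ + (P.η - ((d : ℝ) + 1)) by ring, Real.rpow_add hAQ]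
        ring
    _ ≤ _ := by
        have := Cm_pos (P := P)
        gcongr

end Par2

open Real MeasureTheory Set Filter Topology

theorem wNorm_lt {d : ℕ} (hd : 0 < d) (w : Fin d → ℝ) (hw : ∀ i, 0 < w i) (y : Fin d → ℝ) (A : ℝ) (hA : 0 < A) :
    wNorm w y < A ↔ ∀ i, |y i| < A ^ (w i) := by
  have : Nonempty (Fin d) := ⟨⟨0, hd⟩⟩
  have key : ∀ i, |y i| ^ (1 / w i) < A ↔ |y i| < A ^ (w i) := by
    intro i
    rw [one_div, Real.rpow_inv_lt_iff_of_pos (abs_nonneg _) hA.le (hw i)]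
  unfold wNorm
  constructor
  · intro h i
    rw [← key]
    exact lt_of_le_of_lt (le_ciSup (f := fun i => |y i| ^ (1 / w i)) (Set.finite_range _).bddAbove i) h
  · intro h
    obtain ⟨i, hi⟩ := exists_eq_ciSup_of_finite (f := fun i => |y i| ^ (1 / w i))
    rw [← hi, key]
    exact h i

namespace Par2
variable {d : ℕ} (P : Par2 d)

theorem approx_iff (c : ℝ) (hc : 0 < c) (x : Fin d → ℝ) (p : Fin d → ℤ) (q : ℕ) (hq : 0 < q) :
    wNorm P.w (fun i => (q : ℝ) * x i - (p i : ℝ)) < c * (q : ℝ) ^ (-P.τ) ↔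
      ∀ i, |(q : ℝ) * x i - p i| < c ^ (P.w i) * (q : ℝ) ^ (-(P.τ * P.w i)) := by
  have hq0 : (0 : ℝ) < q := by exact_mod_cast hq
  rw [wNorm_lt P.hd P.w P.hw _ _ (by positivity)]
  have : ∀ i, (c * (q : ℝ) ^ (-P.τ)) ^ (P.w i) = c ^ (P.w i) * (q : ℝ) ^ (-(P.τ * P.w i)) := by
    intro i
    rw [Real.mul_rpow hc.le (by positivity), ← Real.rpow_mul hq0.le]
    ring_nf
  simp only [this]

def KK (f : ℕ → Lev d) (n : ℕ) : Set (Fin d → ℝ) := ⋃ z ∈ (f n).F, P.outer z.1 z.2 (eps n)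

theorem outer_compact (p : Fin d → ℤ) (q : ℕ) (ε : ℝ) : IsCompact (P.outer p q ε) := by
  have : P.outer p q ε = Set.pi univ (fun i => Icc ((p i : ℝ) / q + (1 - 4 * ε) * P.g q i)
      ((p i : ℝ) / q + (1 - ε) * P.g q i)) := by
    ext x; simp only [Par.outer, Set.mem_ofPred_eq, Set.mem_pi, Set.mem_univ, forall_const]
  rw [this]
  exact isCompact_univ_pi fun i => isCompact_Icc

theorem KK_compact (f : ℕ → Lev d) (n : ℕ) : IsCompact (P.KK f n) :=
  (f n).F.isCompact_biUnion fun _ _ => P.outer_compact _ _ _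

theorem gq {q : ℕ} (hq : 0 < q) (i : Fin d) : (q : ℝ) * P.g q i = (q : ℝ) ^ (-(P.τ * P.w i)) := by
  have hq0 : (0 : ℝ) < q := by exact_mod_cast hq
  unfold Par.g
  rw [neg_add_rev, Real.rpow_add hq0, Real.rpow_neg_one]
  field_simp

theorem eps_tendsto : Tendsto eps atTop (𝓝 0) := by
  unfold eps
  have : Tendsto (fun k : ℕ => (k : ℝ) + 8) atTop atTop :=
    tendsto_atTop_add_const_right _ _ tendsto_natCast_atTop_atTop
  simp only [one_div]
  exact this.inv_tendsto_atTop

section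
variable (f : ℕ → Lev d) (ch : ℕ → (Fin d → ℤ) × ℕ → Finset ((Fin d → ℤ) × ℕ))

theorem Q_ge (hN : ∀ k, P.Next k (f k) (f (k + 1)) (ch k)) (n : ℕ) : n ≤ (f n).Q :=
  (strictMono_nat_of_lt_succ fun k => (hN k).hQ).le_apply

theorem KK_succ (hN : ∀ k, P.Next k (f k) (f (k + 1)) (ch k)) (n : ℕ) : P.KK f (n + 1) ⊆ P.KK f n := by
  intro x hx
  simp only [KK, mem_iUnion] at hx ⊢
  obtain ⟨z, hz, hxz⟩ := hx
  obtain ⟨z0, hz0, hzz⟩ := ((hN n).hF z).1 hz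
  exact ⟨z0, hz0, ((hN n).child z0 hz0).sub z hzz hxz⟩

theorem KK_anti (hN : ∀ k, P.Next k (f k) (f (k + 1)) (ch k)) : Antitone (P.KK f) := antitone_nat_of_succ_le fun n => P.KK_succ f ch hN n

theorem KK_exact (h0 : (f 0).F = {(0, 1)}) (hI : ∀ k, P.Inv k (f k))
    (hN : ∀ k, P.Next k (f k) (f (k + 1)) (ch k)) : ⋂ n, P.KK f n ⊆ wExact P.w P.τ := by
  intro x hx
  rw [mem_iInter] at hx
  have hx' : ∀ n, ∃ z ∈ (f n).F, x ∈ P.outer z.1 z.2 (eps n) := by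
    intro n
    have := hx n
    simp only [KK, mem_iUnion] at this
    obtain ⟨z, hz, h⟩ := this
    exact ⟨z, hz, h⟩
  have hbox : ∀ i, x i ∈ Ico (0 : ℝ) 1 := by
    intro i
    obtain ⟨z, hz, h⟩ := hx' 0
    rw [h0, Finset.mem_singleton] at hz
    subst hz
    have := h i
    have hg : P.g 1 i = 1 := by simp [Par.g]
    simp only [Pi.zero_apply, hg, eps] at this
    norm_num at this
    constructor
    · linarith [this.1]
    · linarith [this.2]
  have hlow : ∀ n z, z ∈ (f n).F → x ∈ P.outer z.1 z.2 (eps n) → ∀ i,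
      (1 - 4 * eps n) * (z.2 : ℝ) ^ (-(P.τ * P.w i)) ≤ |(z.2 : ℝ) * x i - z.1 i| ∧
      |(z.2 : ℝ) * x i - z.1 i| ≤ (1 - eps n) * (z.2 : ℝ) ^ (-(P.τ * P.w i)) := by
    intro n z hz h i
    have hq := (hI n).good z hz
    have hq0 := hq.qpos
    have hxi := h i
    have hgp := P.g_pos hq.2.2.1 i
    have e := P.gq hq.2.2.1 i
    have hε := eps_le n
    have e2 : (z.2 : ℝ) * x i - z.1 i = z.2 * (x i - z.1 i / z.2) := by field_simp
    have hnn : 0 ≤ (x i - z.1 i / z.2) := by nlinarith [hxi.1]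
    rw [← e, e2, abs_of_nonneg (mul_nonneg hq0.le hnn)]
    constructor
    · rw [mul_left_comm]
      apply mul_le_mul_of_nonneg_left _ hq0.le
      linarith [hxi.1]
    · rw [mul_left_comm (1 - eps n)]
      apply mul_le_mul_of_nonneg_left _ hq0.le
      linarith [hxi.2]
  refine ⟨⟨hbox, ?_⟩, ?_⟩
  · apply Set.Infinite.of_image Prod.snd
    apply Set.infinite_of_forall_exists_gt
    intro a
    have hc := P.c_pos
    obtain ⟨n, hn⟩ := exists_nat_gt ((a : ℝ) / P.c)
    rw [div_lt_iff₀ hc] at hn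
    obtain ⟨z, hz, h⟩ := hx' n
    have hq := (hI n).good z hz
    refine ⟨z.2, ⟨z, ⟨hq.2.2.1, ?_⟩, rfl⟩, ?_⟩
    · rw [P.approx_iff 1 one_pos x z.1 z.2 hq.2.2.1]
      intro i
      rw [Real.one_rpow, one_mul]
      refine lt_of_le_of_lt (hlow n z hz h i).2 ?_
      have : 0 < (z.2 : ℝ) ^ (-(P.τ * P.w i)) := by have := hq.qpos; positivity
      have := eps_pos n
      nlinarith
    · have h2 := hq.1
      have h3 : (n : ℝ) ≤ (f n).Q := by exact_mod_cast P.Q_ge f ch hN n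
      have : (a : ℝ) < z.2 := by nlinarith
      exact_mod_cast this
  · simp only [mem_iUnion, not_exists]
    rintro c ⟨hc0, hc1⟩ ⟨-, hinf⟩
    apply hinf
    have hcw : ∀ i, c ^ (P.w i) < 1 := fun i => Real.rpow_lt_one hc0.le hc1 (P.hw i)
    have hev : ∀ᶠ n in atTop, ∀ i, 4 * eps n < 1 - c ^ (P.w i) := by
      rw [eventually_all]
      intro i
      have : Tendsto (fun n => 4 * eps n) atTop (𝓝 0) := by simpa using eps_tendsto.const_mul 4
      exact this.eventually_lt_const (by linarith [hcw i])
    obtain ⟨n0, hn0⟩ := eventually_atTop.1 hev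
    have hXlt : ∀ (s : Fin d → ℤ) (r : ℕ), 0 < r →
        (∀ i, |(r : ℝ) * x i - s i| < c ^ (P.w i) * (r : ℝ) ^ (-(P.τ * P.w i))) → (r : ℝ) < (f n0).X := by
      intro s r hr hs
      by_contra hcon
      push Not at hcon
      have hr0 : (0 : ℝ) < r := by exact_mod_cast hr
      have hex : ∃ n, n0 ≤ n ∧ (r : ℝ) ≤ (f (n + 1)).X := by
        refine ⟨max n0 r, le_max_left _ _, ?_⟩
        rw [(hN _).hX]
        have h3 : max n0 r + 1 ≤ (f (max n0 r + 1)).Q := P.Q_ge f ch hN _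
        have h4 : (r : ℝ) ≤ (f (max n0 r + 1)).Q := by
          have : r ≤ (f (max n0 r + 1)).Q := by
            have := le_max_right n0 r
            omega
          exact_mod_cast this
        have h5 : (1 : ℝ) ≤ (f (max n0 r + 1)).Q := by
          have : 1 ≤ (f (max n0 r + 1)).Q := by omega
          exact_mod_cast this
        refine h4.trans ?_
        conv_lhs => rw [← Real.rpow_one (((f (max n0 r + 1)).Q : ℕ) : ℝ)]
        exact Real.rpow_le_rpow_of_exponent_le h5 (by linarith [P.hδ])
      classical
      obtain ⟨hn1, hn2⟩ := Nat.find_spec hex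
      have hmin := fun m => Nat.find_min (m := m) hex
      set n := Nat.find hex with hn
      have hXn : (f n).X ≤ r := by
        rcases hn1.eq_or_lt with h | h
        · rw [← h]; exact hcon
        · have := hmin (n - 1) (by omega)
          rw [not_and] at this
          have := this (by omega)
          rw [Nat.sub_add_cancel (by omega)] at this
          exact le_of_not_ge this
      obtain ⟨z, hz, hxz⟩ := hx' (n + 1)
      obtain ⟨z0, hz0, hzz⟩ := ((hN n).hF z).1 hz
      rw [(hN n).hX] at hn2
      obtain ⟨m, hm1, hm2⟩ := ((hN n).child z0 hz0).noap z hzz x hxz r hXn hn2 s (by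
        intro i
        refine (hs i).trans_le ?_
        have : 0 < (r : ℝ) ^ (-(P.τ * P.w i)) := by positivity
        have := hcw i
        nlinarith)
      have hm0 : 1 ≤ m := by
        rcases Nat.eq_zero_or_pos m with h | h
        · subst h; omega
        · exact h
      have hm0' : (1 : ℝ) ≤ m := by exact_mod_cast hm0
      set i0 : Fin d := ⟨0, P.hd⟩
      have hq0 := ((hI _).good z hz).qpos
      have a1 := hs i0
      have a2 := (hlow _ z hz hxz i0).1
      have a3 := hn0 (n + 1) (by omega) i0
      have e : (r : ℝ) * x i0 - s i0 = m * (z.2 * x i0 - z.1 i0) := by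
        rw [hm1, hm2]; push_cast; ring
      rw [e, abs_mul, abs_of_nonneg (by positivity : (0 : ℝ) ≤ m)] at a1
      have a4 : (r : ℝ) ^ (-(P.τ * P.w i0)) ≤ (z.2 : ℝ) ^ (-(P.τ * P.w i0)) := by
        apply Real.rpow_le_rpow_of_nonpos hq0 _ (by linarith [P.τw_pos i0])
        rw [hm1]; push_cast; nlinarith
      have a5 : 0 < (z.2 : ℝ) ^ (-(P.τ * P.w i0)) := by positivity
      have a6 : 0 < c ^ (P.w i0) := by positivity
      have a7 := abs_nonneg ((z.2 : ℝ) * x i0 - z.1 i0)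
      nlinarith
    obtain ⟨N, hNX⟩ := exists_nat_ge (f n0).X
    apply Set.Finite.subset (((Set.finite_Icc (fun _ : Fin d => -((N : ℤ) + 1)) (fun _ => (N : ℤ) + 1))).prod
      (Set.finite_Iic N))
    rintro ⟨s, r⟩ ⟨hr, hs⟩
    simp only at hr hs
    have hs' := (P.approx_iff c hc0 x s r hr).1 hs
    have hrX := hXlt s r hr hs'
    have hrN : (r : ℝ) ≤ N := hrX.le.trans hNX
    have hr1 : (1 : ℝ) ≤ r := by exact_mod_cast hr
    have hsi : ∀ i, |(s i : ℝ)| ≤ N + 1 := by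
      intro i
      have b1 := hs' i
      have b2 : (r : ℝ) ^ (-(P.τ * P.w i)) ≤ 1 := Real.rpow_le_one_of_one_le_of_nonpos hr1 (by linarith [P.τw_pos i])
      have b3 : 0 < (r : ℝ) ^ (-(P.τ * P.w i)) := by positivity
      have b4 := hcw i
      have b5 : |(r : ℝ) * x i - s i| < 1 := by nlinarith
      have b6 := abs_lt.1 b5
      have b7 := (hbox i).1
      have b8 := (hbox i).2
      rw [abs_le]
      constructor <;> nlinarith
    refine ⟨⟨fun i => ?_, fun i => ?_⟩, ?_⟩
    · have := (abs_le.1 (hsi i)).1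
      have : ((-((N : ℤ) + 1) : ℤ) : ℝ) ≤ s i := by push_cast; exact this
      exact_mod_cast this
    · have := (abs_le.1 (hsi i)).2
      have : (s i : ℝ) ≤ (((N : ℤ) + 1 : ℤ) : ℝ) := by push_cast; exact this
      exact_mod_cast this
    · exact_mod_cast hrN

theorem box_mass (h1 : (f 0).Q = 1) (hI : ∀ k, P.Inv k (f k))
    (hN : ∀ k, P.Next k (f k) (f (k + 1)) (ch k)) (U : Set (Fin d → ℝ)) (a : Fin d → ℝ) (r : ℝ) (hr0 : 0 < r) (hr1 : r ≤ 1)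
    (hU : ∀ x ∈ U, ∀ i, x i ∈ Icc (a i) (a i + r)) :
    ∀ᶠ n in atTop, P.M n (f n) U ≤ P.Cm * r ^ P.s := by
  have hex : ∃ k, ((f (k + 1)).Q : ℝ)⁻¹ ≤ r := by
    obtain ⟨n, hn⟩ := exists_nat_ge (r⁻¹)
    refine ⟨n, ?_⟩
    apply inv_le_of_inv_le₀ hr0
    refine hn.trans ?_
    have := P.Q_ge f ch hN (n + 1)
    exact_mod_cast (by omega : n ≤ (f (n + 1)).Q)
  classical
  have hk1 := Nat.find_spec hex
  have hmin := fun m => Nat.find_min (m := m) hex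
  set k := Nat.find hex with hk
  have hk2 : r ≤ ((f k).Q : ℝ)⁻¹ := by
    rcases Nat.eq_zero_or_pos k with h | h
    · rw [h, h1]; simpa using hr1
    · have := hmin (k - 1) (by omega)
      rw [Nat.sub_add_cancel (by omega)] at this
      exact le_of_not_ge this
  have hkey := M_key (hI k) (hN k) U a r hr0 hU hk1 hk2
  filter_upwards [eventually_ge_atTop (k + 1)] with n hn
  refine le_trans ?_ hkey
  induction n, hn using Nat.le_induction with
  | base => exact le_rfl
  | succ n hn ih => exact (M_anti (hI n) (hN n) U).trans ih

theorem dim_K (h1 : (f 0).Q = 1) (hI : ∀ k, P.Inv k (f k))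
    (hN : ∀ k, P.Next k (f k) (f (k + 1)) (ch k)) : ENNReal.ofReal P.s ≤ dimH (⋂ n, P.KK f n) := by
  by_contra hcon
  push Not at hcon
  have hs := P.hs
  have hCm := Cm_pos (P := P)
  have hzero : μH[P.s] (⋂ n, P.KK f n) = 0 := by
    have := hausdorffMeasure_of_dimH_lt (X := Fin d → ℝ) (d := P.s.toNNReal) hcon
    rwa [Real.coe_toNNReal _ hs.le] at this
  set e0 : ℝ := 1 / (4 * P.Cm * 4 ^ P.s) with he0
  have he0p : 0 < e0 := by positivity
  rw [Measure.hausdorffMeasure_apply] at hzero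
  have hz2 := (le_of_eq hzero)
  rw [iSup_le_iff] at hz2
  have hz3 := hz2 (ENNReal.ofReal (1 / 4))
  rw [iSup_le_iff] at hz3
  have hz4 := lt_of_le_of_lt (hz3 (by simp)) (by simpa using he0p : (0 : ENNReal) < ENNReal.ofReal e0)
  simp only [iInf_lt_iff] at hz4
  obtain ⟨t, htc, htd, hts⟩ := hz4
  have hDt : ∀ n, Metric.ediam (t n) ≠ ⊤ := fun n => ne_top_of_le_ne_top ENNReal.ofReal_ne_top (htd n)
  set D : ℕ → ℝ := fun n => (Metric.ediam (t n)).toReal with hD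
  have hD0 : ∀ n, 0 ≤ D n := fun n => ENNReal.toReal_nonneg
  have hD4 : ∀ n, D n ≤ 1 / 4 := fun n => by
    have := ENNReal.toReal_mono ENNReal.ofReal_ne_top (htd n)
    rwa [ENNReal.toReal_ofReal (by norm_num)] at this
  have hDsum : ∀ T : Finset ℕ, ∑ n ∈ T, (D n) ^ P.s ≤ e0 := by
    intro T
    have hh : ∑ n ∈ T, ENNReal.ofReal ((D n) ^ P.s) ≤ ENNReal.ofReal e0 := by
      refine le_trans ?_ hts.le
      refine le_trans ?_ (ENNReal.sum_le_tsum T)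
      apply Finset.sum_le_sum
      intro n _
      rcases (t n).eq_empty_or_nonempty with hh | hh
      · have : D n = 0 := by simp [hD, hh]
        rw [this, Real.zero_rpow hs.ne']
        simp
      · refine le_trans ?_ (le_iSup _ hh)
        rw [hD, ENNReal.toReal_rpow, ENNReal.ofReal_toReal]
        exact ENNReal.rpow_ne_top_of_nonneg hs.le (hDt n)
    rw [← ENNReal.ofReal_sum_of_nonneg (fun n _ => Real.rpow_nonneg (hD0 n) _),
      ENNReal.ofReal_le_ofReal_iff he0p.le] at hh
    exact hh
  have hxe : ∀ n, ∃ x : Fin d → ℝ, (t n).Nonempty → x ∈ t n := by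
    intro n
    by_cases hh : (t n).Nonempty
    · exact ⟨hh.some, fun _ => hh.some_mem⟩
    · exact ⟨0, fun h => absurd h hh⟩
  choose x hx using hxe
  set E : ℝ := min e0 ((1 / 4) ^ P.s) with hE
  have hEp : 0 < E := lt_min he0p (by positivity)
  set u : ℕ → ℝ := fun n => (E * (1 / 2) ^ (n + 1)) ^ P.s⁻¹ with hu
  have hup : ∀ n, 0 < u n := fun n => by positivity
  have hus : ∀ n, (u n) ^ P.s = E * (1 / 2) ^ (n + 1) := by
    intro n
    rw [hu, ← Real.rpow_mul (by positivity), inv_mul_cancel₀ hs.ne', Real.rpow_one]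
  have hu4 : ∀ n, u n ≤ 1 / 4 := by
    intro n
    have h2 : (u n) ^ P.s ≤ (1 / 4) ^ P.s := by
      rw [hus]
      have : (1 / 2 : ℝ) ^ (n + 1) ≤ 1 := pow_le_one₀ (by norm_num) (by norm_num)
      have h3 : E ≤ (1 / 4) ^ P.s := min_le_right _ _
      nlinarith
    exact (Real.rpow_le_rpow_iff (hup n).le (by norm_num) hs).1 h2
  set ρ : ℕ → ℝ := fun n => max (2 * D n) (u n) with hρ
  have hρ0 : ∀ n, 0 < ρ n := fun n => lt_max_of_lt_right (hup n)
  have hρ2 : ∀ n, ρ n ≤ 1 / 2 := fun n => max_le (by linarith [hD4 n]) (by linarith [hu4 n])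
  have hρs : ∀ n, (2 * ρ n) ^ P.s ≤ 4 ^ P.s * (D n) ^ P.s + 4 ^ P.s * (E * (1 / 2) ^ (n + 1)) := by
    intro n
    have hD' := hD0 n
    have hu' := hup n
    have k1 : 0 ≤ (4 : ℝ) ^ P.s * (D n) ^ P.s := by positivity
    have k2 : 0 ≤ (4 : ℝ) ^ P.s * (E * (1 / 2) ^ (n + 1)) := by positivity
    rcases max_cases (2 * D n) (u n) with ⟨hh, -⟩ | ⟨hh, -⟩
    · have e : 2 * ρ n = 4 * D n := by rw [hρ]; simp only [hh]; ring
      rw [e, Real.mul_rpow (by norm_num) hD']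
      linarith
    · have e : 2 * ρ n ≤ 4 * u n := by rw [hρ]; simp only [hh]; linarith
      have := Real.rpow_le_rpow (by have := hρ0 n; positivity) e hs.le
      rw [Real.mul_rpow (by norm_num) hu'.le, hus] at this
      linarith
  have htV : ∀ n, t n ⊆ Metric.ball (x n) (ρ n) := by
    intro n y hy
    have hxn := hx n ⟨y, hy⟩
    have : edist y (x n) ≤ Metric.ediam (t n) := Metric.edist_le_ediam_of_mem hy hxn
    have h2 : dist y (x n) ≤ D n := by
      rw [dist_edist]
      exact ENNReal.toReal_mono (hDt n) this
    rw [Metric.mem_ball]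
    rcases (hD0 n).eq_or_lt with hh | hh
    · exact lt_of_le_of_lt h2 (by rw [← hh]; exact hρ0 n)
    · exact lt_of_lt_of_le (by linarith : dist y (x n) < 2 * D n) (le_max_left _ _)
  have hopen : IsOpen (⋃ n, Metric.ball (x n) (ρ n)) := isOpen_iUnion fun n => Metric.isOpen_ball
  have hKV : (⋂ n, P.KK f n) ⊆ ⋃ n, Metric.ball (x n) (ρ n) := htc.trans (iUnion_mono htV)
  obtain ⟨N, hN'⟩ := exists_subset_nhds_of_isCompact (V := P.KK f) (P.KK_anti f ch hN).directed_ge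
    (P.KK_compact f) (U := ⋃ n, Metric.ball (x n) (ρ n)) (fun y hy => hopen.mem_nhds (hKV hy))
  obtain ⟨T, hT⟩ := (P.KK_compact f N).elim_finite_subcover (fun n => Metric.ball (x n) (ρ n))
    (fun n => Metric.isOpen_ball) hN'
  have hmass : ∀ᶠ n in atTop, ∀ j ∈ T, P.M n (f n) (Metric.ball (x j) (ρ j)) ≤ P.Cm * (2 * ρ j) ^ P.s := by
    rw [Finset.eventually_all]
    intro j _
    apply P.box_mass f ch h1 hI hN _ (fun i => x j i - ρ j) (2 * ρ j) (by linarith [hρ0 j]) (by linarith [hρ2 j])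
    intro y hy i
    have h2 : dist (y i) (x j i) < ρ j := lt_of_le_of_lt (dist_le_pi_dist y (x j) i) hy
    rw [Real.dist_eq, abs_lt] at h2
    constructor
    · linarith [h2.1]
    · linarith [h2.2]
  obtain ⟨n, hn1, hn2⟩ := (hmass.and (eventually_ge_atTop N)).exists
  have hKn : P.KK f n ⊆ ⋃ j ∈ T, Metric.ball (x j) (ρ j) := (P.KK_anti f ch hN hn2).trans hT
  have hge : 1 ≤ ∑ j ∈ T, P.M n (f n) (Metric.ball (x j) (ρ j)) := by
    classical
    unfold M
    rw [Finset.sum_comm]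
    refine (hI n).msum.symm.le.trans ?_
    apply Finset.sum_le_sum
    intro z hz
    rw [← Finset.mul_sum]
    have hgood := (hI n).good z hz
    set y : Fin d → ℝ := fun i => (z.1 i : ℝ) / z.2 + (1 - 4 * eps n) * P.g z.2 i with hy
    have hyo : y ∈ P.outer z.1 z.2 (eps n) := by
      intro i
      have := P.g_pos hgood.2.2.1 i
      have := eps_pos n
      constructor
      · exact le_rfl
      · simp only [hy]; nlinarith
    have hyK : y ∈ P.KK f n := by
      simp only [KK, mem_iUnion]
      exact ⟨z, hz, hyo⟩
    have := hKn hyK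
    simp only [mem_iUnion] at this
    obtain ⟨j, hj, hyj⟩ := this
    have h3 : (1 : ℝ) ≤ ∑ j ∈ T, if (P.outer z.1 z.2 (eps n) ∩ Metric.ball (x j) (ρ j)).Nonempty then (1 : ℝ) else 0 := by
      refine le_trans ?_ (Finset.single_le_sum (fun j _ => by split_ifs <;> norm_num) hj)
      rw [if_pos ⟨y, hyo, hyj⟩]
    have := (hI n).m0 z
    nlinarith
  have hle : ∑ j ∈ T, P.M n (f n) (Metric.ball (x j) (ρ j)) ≤ 1 / 2 := by
    have hgeom : ∑ j ∈ T, (1 / 2 : ℝ) ^ (j + 1) ≤ 1 := by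
      have hs1 : HasSum (fun j : ℕ => (1 / 2 : ℝ) ^ (j + 1)) 1 := by
        have := (hasSum_geometric_two).mul_right (1 / 2)
        simpa [pow_succ] using this
      exact sum_le_hasSum T (fun j _ => by positivity) hs1
    calc _ ≤ ∑ j ∈ T, P.Cm * (4 ^ P.s * (D j) ^ P.s + 4 ^ P.s * (E * (1 / 2) ^ (j + 1))) := by
          apply Finset.sum_le_sum
          intro j hj
          exact (hn1 j hj).trans (mul_le_mul_of_nonneg_left (hρs j) hCm.le)
      _ = P.Cm * 4 ^ P.s * (∑ j ∈ T, (D j) ^ P.s) + P.Cm * 4 ^ P.s * E * (∑ j ∈ T, (1 / 2 : ℝ) ^ (j + 1)) := by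
          rw [Finset.mul_sum, Finset.mul_sum, ← Finset.sum_add_distrib]
          apply Finset.sum_congr rfl
          intro j _
          ring
      _ ≤ P.Cm * 4 ^ P.s * e0 + P.Cm * 4 ^ P.s * e0 * 1 := by
          gcongr
          · exact hDsum T
          · exact min_le_left _ _
      _ = 1 / 2 := by
          rw [he0]; field_simp; norm_num
  linarith
end

theorem lower : ENNReal.ofReal P.s ≤ dimH (wExact P.w P.τ) := by
  obtain ⟨f, ch, h0, h1, hI, hN⟩ := P.seq_exists
  exact (P.dim_K f ch h1 hI hN).trans (dimH_mono (P.KK_exact f ch h0 hI hN))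
end Par2

open Real MeasureTheory Set Filter Topology

theorem exists_pos_le {d : ℕ} (hd : 0 < d) (f : Fin d → ℝ) (hf : ∀ i, 0 < f i) : ∃ γ > 0, ∀ i, γ ≤ f i := by
  have : Nonempty (Fin d) := ⟨⟨0, hd⟩⟩
  obtain ⟨i, hi⟩ := Finite.exists_min f
  exact ⟨f i, hf i, hi⟩

/-- the `j`-th candidate for the dimension -/
noncomputable def sj {d : ℕ} (w : Fin d → ℝ) (τ : ℝ) (j : Fin d) : ℝ :=
  ((d : ℝ) + 1 + τ * ∑ i, max (w j - w i) 0) / (1 + τ * w j)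

theorem convex_min {d : ℕ} (Y : Fin d → ℝ) (B s : ℝ) (hs0 : 0 < s) (hsd : s ≤ d)
    (h : ∀ j, s * Y j ≤ B + ∑ i, max (Y j - Y i) 0) (y : ℝ) : s * y ≤ B + ∑ i, max (y - Y i) 0 := by
  classical
  set J : Finset (Fin d) := Finset.univ.filter fun i => Y i ≤ y with hJ
  have hsum : ∀ z : ℝ, ∑ i, max (z - Y i) 0 = ∑ i ∈ J, max (z - Y i) 0 + ∑ i ∈ Finset.univ.filter (fun i => ¬ Y i ≤ y), max (z - Y i) 0 :=
    fun z => (Finset.sum_filter_add_sum_filter_not _ _ _).symm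
  have hy : ∑ i, max (y - Y i) 0 = ∑ i ∈ J, (y - Y i) := by
    rw [hsum, Finset.sum_eq_zero (s := Finset.univ.filter (fun i => ¬ Y i ≤ y)), add_zero]
    · apply Finset.sum_congr rfl
      intro i hi
      apply max_eq_left
      linarith [(Finset.mem_filter.1 hi).2]
    · intro i hi
      apply max_eq_right
      linarith [lt_of_not_ge (Finset.mem_filter.1 hi).2]
  rw [hy]
  by_cases hJs : s ≤ J.card
  · have hne : J.Nonempty := by
      rw [← Finset.card_pos]
      have : (0 : ℝ) < J.card := by linarith
      exact_mod_cast this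
    obtain ⟨j, hj, hmax⟩ := J.exists_max_image Y hne
    have hjy : Y j ≤ y := (Finset.mem_filter.1 hj).2
    have h1 := h j
    have h2 : ∑ i, max (Y j - Y i) 0 = ∑ i ∈ J, (Y j - Y i) := by
      rw [hsum, Finset.sum_eq_zero (s := Finset.univ.filter (fun i => ¬ Y i ≤ y)), add_zero]
      · apply Finset.sum_congr rfl
        intro i hi
        apply max_eq_left
        linarith [hmax i hi]
      · intro i hi
        apply max_eq_right
        linarith [lt_of_not_ge (Finset.mem_filter.1 hi).2]
    have h3 : ∑ i ∈ J, (y - Y i) = J.card * (y - Y j) + ∑ i ∈ J, (Y j - Y i) := by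
      rw [← nsmul_eq_mul, ← Finset.sum_const, ← Finset.sum_add_distrib]
      apply Finset.sum_congr rfl
      intro i _; ring
    rw [h3, ← h2]
    nlinarith
  · push Not at hJs
    have hne : (Finset.univ.filter (fun i => ¬ Y i ≤ y)).Nonempty := by
      by_contra hcon
      rw [Finset.not_nonempty_iff_eq_empty, Finset.filter_eq_empty_iff] at hcon
      have : J = Finset.univ := by
        rw [hJ, Finset.filter_eq_self]
        intro i hi
        exact not_not.1 (hcon hi)
      rw [this] at hJs
      simp at hJs
      linarith
    obtain ⟨j, hj, hmin⟩ := Finset.exists_min_image _ Y hne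
    have hjy : y < Y j := lt_of_not_ge (Finset.mem_filter.1 hj).2
    have h1 := h j
    have h2 : ∑ i, max (Y j - Y i) 0 = ∑ i ∈ J, (Y j - Y i) := by
      rw [hsum, Finset.sum_eq_zero (s := Finset.univ.filter (fun i => ¬ Y i ≤ y)), add_zero]
      · apply Finset.sum_congr rfl
        intro i hi
        apply max_eq_left
        linarith [(Finset.mem_filter.1 hi).2]
      · intro i hi
        apply max_eq_right
        linarith [hmin i hi]
    have h3 : ∑ i ∈ J, (y - Y i) = J.card * (y - Y j) + ∑ i ∈ J, (Y j - Y i) := by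
      rw [← nsmul_eq_mul, ← Finset.sum_const, ← Finset.sum_add_distrib]
      apply Finset.sum_congr rfl
      intro i _; ring
    rw [h3, ← h2]
    nlinarith

theorem exists_sj_le {d : ℕ} (hd : 0 < d) (w : Fin d → ℝ) (hw : ∀ i, 0 < w i) (hsum : ∑ i, w i = 1) (τ : ℝ)
    (hτ : 1 < τ) : ∃ j, sj w τ j ≤ d := by
  have : Nonempty (Fin d) := ⟨⟨0, hd⟩⟩
  obtain ⟨j, hj⟩ := Finite.exists_max w
  refine ⟨j, ?_⟩
  unfold sj
  have h1 : ∑ i, max (w j - w i) 0 = d * w j - 1 := by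
    rw [Finset.sum_congr rfl (fun i _ => max_eq_left (by linarith [hj i] : 0 ≤ w j - w i)),
      Finset.sum_sub_distrib, hsum]
    simp
  have := hw j
  rw [h1, div_le_iff₀ (by positivity)]
  nlinarith

theorem lower_main {d : ℕ} (hd : 0 < d) (w : Fin d → ℝ) (hw : ∀ i, 0 < w i) (hsum : ∑ i, w i = 1) (τ : ℝ)
    (hτ : 1 < τ) (s : ℝ) (hs0 : 0 < s) (hs : ∀ j, s < sj w τ j) :
    ENNReal.ofReal s ≤ dimH (wExact w τ) := by
  obtain ⟨γ, hγ0, hγ⟩ := exists_pos_le hd (fun j => sj w τ j - s) (fun j => by linarith [hs j])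
  obtain ⟨j0, hj0⟩ := exists_sj_le hd w hw hsum τ hτ
  have hsd : s + γ ≤ d := by linarith [hγ j0]
  set θ : ℝ := min (γ / 3) ((τ - 1) / 2) with hθ
  have hθ0 : 0 < θ := lt_min (by linarith) (by linarith)
  have hθ1 : θ ≤ γ / 3 := min_le_left _ _
  have hθ2 : θ ≤ (τ - 1) / 2 := min_le_right _ _
  set τ' : ℝ := τ - θ with hτ'
  have hτ'1 : 1 < τ' := by linarith
  have hτ'τ : τ' < τ := by linarith
  have hcont : ContinuousOn (fun l : ℝ => ∑ i, min (τ' * w i) l) (Icc 0 τ') := by fun_prop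
  obtain ⟨l, ⟨hl0, hl1⟩, hl⟩ : ∃ l ∈ Icc 0 τ', ∑ i, min (τ' * w i) l = 1 := by
    have := intermediate_value_Icc (by linarith : (0 : ℝ) ≤ τ') hcont
    apply this
    constructor
    · have : ∑ i, min (τ' * w i) 0 = 0 := Finset.sum_eq_zero fun i _ =>
        min_eq_right (by have := hw i; nlinarith)
      simp only [this]; norm_num
    · have : ∑ i, min (τ' * w i) τ' = τ' := by
        rw [Finset.sum_congr rfl (fun i _ => min_eq_left (?_ : τ' * w i ≤ τ')), ← Finset.mul_sum, hsum, mul_one]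
        have : w i ≤ 1 := by
          rw [← hsum]; exact Finset.single_le_sum (fun i _ => (hw i).le) (Finset.mem_univ i)
        nlinarith
      simp only [this]; linarith
  have hlpos : 0 < l := by
    rcases hl0.eq_or_lt with h | h
    · exfalso
      have : ∑ i, min (τ' * w i) l = 0 := Finset.sum_eq_zero fun i _ => by
        rw [← h]
        exact min_eq_right (by have := hw i; nlinarith)
      linarith
    · exact h
  set v : Fin d → ℝ := fun i => min (τ' * w i) l with hv
  have hvpos : ∀ i, 0 < v i := fun i => lt_min (by have := hw i; nlinarith) hlpos
  set b : ℝ := √(τ / τ') with hb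
  have hbsq : b ^ 2 = τ / τ' := Real.sq_sqrt (by positivity)
  have hb1 : 1 < b := by
    rw [hb, Real.lt_sqrt (by norm_num), one_pow, one_lt_div (by linarith)]
    exact hτ'τ
  obtain ⟨δ, hδ0, hδ⟩ := exists_pos_le hd (fun i => (b ^ 2 - b) * v i)
    (fun i => mul_pos (by nlinarith) (hvpos i))
  have hvb : ∀ i, b ^ 2 * v i ≤ τ * w i := by
    intro i
    have h1 : v i ≤ τ' * w i := min_le_left _ _
    calc b ^ 2 * v i ≤ b ^ 2 * (τ' * w i) := by gcongr
      _ = τ * w i := by rw [hbsq]; field_simp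
  -- the exponent inequality
  have key : ∀ x y : ℝ, 0 ≤ x → x ≤ y →
      (s + γ) * y - ((d : ℝ) + 1) * x + ∑ i, max 0 (x * (1 + v i) - y) - ∑ i, max 0 (y - x * (1 + τ * w i)) ≤
        θ * x := by
    intro x y hx hxy
    by_cases hyl : y ≤ x * (1 + l)
    · have h1 : ∀ i, max 0 (x * (1 + v i) - y) - max 0 (y - x * (1 + τ * w i)) ≤
          x * (1 + v i) - y + x * (θ * w i) := by
        intro i
        have hwi := hw i
        have hp : 0 ≤ x * (θ * w i) := by positivity
        have e : τ * w i = τ' * w i + θ * w i := by rw [hτ']; ring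
        have ex : x * (1 + τ * w i) = x * (1 + τ' * w i) + x * (θ * w i) := by rw [e]; ring
        rcases min_cases (τ' * w i) l with ⟨hh, hh2⟩ | ⟨hh, hh2⟩
        · have hvi : v i = τ' * w i := hh
          rw [hvi, ex]
          rcases max_cases 0 (x * (1 + τ' * w i) - y) with ⟨g1, g2⟩ | ⟨g1, g2⟩ <;>
          rcases max_cases 0 (y - (x * (1 + τ' * w i) + x * (θ * w i))) with ⟨g3, g4⟩ | ⟨g3, g4⟩ <;>
          rw [g1, g3] <;> linarith
        · have hvi : v i = l := hh
          rw [hvi, max_eq_right (by linarith)]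
          have := le_max_left 0 (y - x * (1 + τ * w i))
          linarith
      have h2 := Finset.sum_le_sum (s := Finset.univ) fun i _ => h1 i
      have h3 : ∑ i, (x * (1 + v i) - y + x * (θ * w i)) = x * (d + 1) - d * y + x * θ := by
        rw [Finset.sum_add_distrib, Finset.sum_sub_distrib, ← Finset.mul_sum, ← Finset.mul_sum, ← Finset.mul_sum,
          Finset.sum_add_distrib, hsum]
        rw [show ∑ i, v i = 1 from hl]
        simp
      rw [h3, Finset.sum_sub_distrib] at h2
      nlinarith
    · push Not at hyl
      have h1 : ∑ i, max 0 (x * (1 + v i) - y) = 0 := by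
        apply Finset.sum_eq_zero
        intro i _
        apply max_eq_left
        have : v i ≤ l := min_le_right _ _
        nlinarith
      have h2 := convex_min (fun i => x * (1 + τ * w i)) (((d : ℝ) + 1) * x) (s + γ) (by linarith) hsd (by
        intro j
        have hj := hγ j
        have hwj := hw j
        have h3 : s + γ ≤ sj w τ j := by linarith
        unfold sj at h3
        rw [le_div_iff₀ (by positivity)] at h3
        have h4 : ∑ i, max (x * (1 + τ * w j) - x * (1 + τ * w i)) 0 = x * (τ * ∑ i, max (w j - w i) 0) := by
          rw [Finset.mul_sum, Finset.mul_sum]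
          apply Finset.sum_congr rfl
          intro i _
          rw [mul_max_of_nonneg _ _ (by linarith : 0 ≤ τ), mul_max_of_nonneg _ _ hx]
          congr 1 <;> ring
        rw [h4]
        nlinarith) y
      have h3 : ∑ i, max (y - x * (1 + τ * w i)) 0 = ∑ i, max 0 (y - x * (1 + τ * w i)) :=
        Finset.sum_congr rfl fun i _ => max_comm _ _
      rw [h3] at h2
      rw [h1]
      have : 0 ≤ θ * x := by positivity
      linarith
  have hexp : ∀ Q r : ℝ, 1 ≤ Q → 0 < r → r ≤ Q⁻¹ →
      Q ^ (γ / 3 + γ / 3 - ((d : ℝ) + 1)) *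
        ∏ i, (max 1 (r * Q ^ (1 + v i)) * min 1 (r * Q ^ (1 + τ * w i))) ≤ r ^ s := by
    intro Q r hQ hr hrQ
    have hQ0 : 0 < Q := by linarith
    obtain ⟨x, rfl⟩ : ∃ x, Q = Real.exp x := ⟨Real.log Q, (Real.exp_log hQ0).symm⟩
    obtain ⟨y, rfl⟩ : ∃ y, r = Real.exp (-y) := ⟨-Real.log r, by rw [neg_neg, Real.exp_log hr]⟩
    have hx : 0 ≤ x := Real.one_le_exp_iff.1 hQ
    have hxy : x ≤ y := by
      rw [← Real.exp_neg, Real.exp_le_exp] at hrQ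
      linarith
    have hk := key x y hx hxy
    have e1 : ∀ a : ℝ, max 1 (Real.exp (-y) * Real.exp x ^ (1 + a)) = Real.exp (max 0 (x * (1 + a) - y)) := by
      intro a
      rw [Real.exp_monotone.map_max, Real.exp_zero, ← Real.exp_mul, ← Real.exp_add]
      congr 2; ring
    have e2 : ∀ a : ℝ, min 1 (Real.exp (-y) * Real.exp x ^ (1 + a)) = Real.exp (-max 0 (y - x * (1 + a))) := by
      intro a
      have : -max 0 (y - x * (1 + a)) = min 0 (x * (1 + a) - y) := by
        rw [max_def, min_def]; split_ifs <;> linarith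
      rw [this, Real.exp_monotone.map_min, Real.exp_zero, ← Real.exp_mul, ← Real.exp_add]
      congr 2; ring
    simp only [e1, e2]
    simp only [← Real.exp_mul, ← Real.exp_add]
    rw [← Real.exp_sum, ← Real.exp_add, Real.exp_le_exp, Finset.sum_add_distrib, Finset.sum_neg_distrib]
    have : θ * x ≤ γ / 3 * x := by gcongr
    have : γ * x ≤ γ * y := by gcongr
    linarith
  let P : Par d := ⟨w, v, τ, b, δ, hd, hw, hsum, hτ, hvpos, hl, hb1, hvb, hδ0, hδ⟩
  exact Par2.lower (d := d) ⟨P, γ / 3, γ / 3, s, by linarith, by linarith, hs0, hexp⟩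

open Real MeasureTheory Set Filter Topology

theorem haus_zero {X : Type*} [MetricSpace X] [MeasurableSpace X] [BorelSpace X] (S : Set X)
    (κ : ℕ → Type) [∀ q, Fintype (κ q)] (t : ∀ q, κ q → Set X) (ρ : ℕ → ℝ) (s : ℝ) (hs : 0 ≤ s)
    (hρ0 : ∀ q, 0 ≤ ρ q) (hρa : Antitone ρ) (hρ : Tendsto ρ atTop (𝓝 0))
    (ht : ∀ q k, Metric.ediam (t q k) ≤ ENNReal.ofReal (ρ q))
    (hS : ∀ x ∈ S, ∀ n, ∃ q, n ≤ q ∧ ∃ k, x ∈ t q k)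
    (hsum : Summable fun q => (Fintype.card (κ q) : ℝ) * ρ q ^ s) :
    μH[s] S = 0 := by
  have h1 := Measure.hausdorffMeasure_le_liminf_tsum (β := ℕ) (ι := fun n => Σ m : ℕ, κ (m + n)) s S (l := atTop)
    (fun n => ENNReal.ofReal (ρ n)) (by
      have := ENNReal.tendsto_ofReal hρ
      simpa using this)
    (fun n a => t (a.1 + n) a.2)
    (Eventually.of_forall fun n a => (ht _ _).trans (ENNReal.ofReal_le_ofReal (hρa (by omega))))
    (Eventually.of_forall fun n x hx => by
      obtain ⟨q, hq, k, hk⟩ := hS x hx n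
      obtain ⟨m, rfl⟩ : ∃ m, q = m + n := ⟨q - n, by omega⟩
      exact mem_iUnion.2 ⟨⟨m, k⟩, hk⟩)
  have h2 : Tendsto (fun n => ∑' m, ENNReal.ofReal ((Fintype.card (κ (m + n)) : ℝ) * ρ (m + n) ^ s)) atTop (𝓝 0) :=
    ENNReal.tendsto_sum_nat_add (fun q => ENNReal.ofReal ((Fintype.card (κ q) : ℝ) * ρ q ^ s))
      hsum.tsum_ofReal_ne_top
  have h3 : ∀ n, ∑' a : (Σ m : ℕ, κ (m + n)), Metric.ediam (t (a.1 + n) a.2) ^ s ≤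
      ∑' m, ENNReal.ofReal ((Fintype.card (κ (m + n)) : ℝ) * ρ (m + n) ^ s) := by
    intro n
    rw [ENNReal.tsum_sigma (fun m (k : κ (m + n)) => Metric.ediam (t (m + n) k) ^ s)]
    refine ENNReal.tsum_le_tsum fun m => ?_
    rw [tsum_fintype]
    calc ∑ b, Metric.ediam (t (m + n) b) ^ s ≤ ∑ b : κ (m + n), ENNReal.ofReal (ρ (m + n)) ^ s := by
          refine Finset.sum_le_sum fun b _ => ENNReal.rpow_le_rpow (ht _ _) hs
      _ = _ := by
          rw [Finset.sum_const, ENNReal.ofReal_rpow_of_nonneg (hρ0 _) hs, ENNReal.ofReal_mul (by positivity),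
            ENNReal.ofReal_natCast, nsmul_eq_mul, Finset.card_univ]
  have h4 : Tendsto (fun n => ∑' a : (Σ m : ℕ, κ (m + n)), Metric.ediam (t (a.1 + n) a.2) ^ s) atTop (𝓝 0) :=
    tendsto_of_tendsto_of_tendsto_of_le_of_le tendsto_const_nhds h2 (fun _ => zero_le) h3
  rw [h4.liminf_eq] at h1
  exact le_antisymm h1 zero_le

theorem inf_q {d : ℕ} (hd : 0 < d) (w : Fin d → ℝ) (hw : ∀ i, 0 < w i) (τ : ℝ) (hτ : 1 < τ) (x : Fin d → ℝ)
    (hx : x ∈ wApprox w 1 τ) (n : ℕ) :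
    ∃ q : ℕ, n ≤ q ∧ ∃ p : Fin d → Fin (q + 2), ∀ i,
      |((q + 1 : ℕ) : ℝ) * x i - ((p i : ℕ) : ℝ)| < ((q + 1 : ℕ) : ℝ) ^ (-(τ * w i)) := by
  obtain ⟨hx0, hinf⟩ := hx
  have key : ∀ p : Fin d → ℤ, ∀ q : ℕ, 0 < q →
      wNorm w (fun i => (q : ℝ) * x i - (p i : ℝ)) < 1 * (q : ℝ) ^ (-τ) →
      ∀ i, |(q : ℝ) * x i - (p i : ℝ)| < (q : ℝ) ^ (-(τ * w i)) ∧ 0 ≤ p i ∧ p i ≤ q := by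
    intro p q hq h i
    have hq1 : (1 : ℝ) ≤ q := by exact_mod_cast hq
    have hq0 : (0 : ℝ) < q := by linarith
    rw [one_mul, wNorm_lt hd w hw _ _ (by positivity)] at h
    have hi := h i
    rw [← Real.rpow_mul hq0.le, neg_mul] at hi
    refine ⟨hi, ?_⟩
    have hle : (q : ℝ) ^ (-(τ * w i)) ≤ 1 :=
      Real.rpow_le_one_of_one_le_of_nonpos hq1 (by have := hw i; nlinarith)
    have h1 := abs_lt.1 (hi.trans_le hle)
    obtain ⟨g1, g2⟩ := hx0 i
    constructor
    · have : (-1 : ℝ) < p i := by nlinarith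
      have : (-1 : ℤ) < p i := by exact_mod_cast this
      omega
    · have : (p i : ℝ) < q + 1 := by nlinarith
      have : p i < (q : ℤ) + 1 := by exact_mod_cast this
      omega
  have : ∃ pq ∈ {pq : (Fin d → ℤ) × ℕ | 0 < pq.2 ∧
      wNorm w (fun i => (pq.2 : ℝ) * x i - (pq.1 i : ℝ)) < 1 * (pq.2 : ℝ) ^ (-τ)}, n + 1 ≤ pq.2 := by
    by_contra hcon
    push Not at hcon
    apply hinf
    refine Set.Finite.subset ((Set.Finite.pi' (t := fun _ : Fin d => Set.Icc (0 : ℤ) n)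
      (fun i => Set.finite_Icc _ _)).prod (Set.finite_Iic n)) ?_
    rintro ⟨p, q⟩ h
    have hc := hcon _ h
    have hk := key p q h.1 h.2
    simp only at hc
    refine ⟨fun i => ⟨(hk i).2.1, ?_⟩, ?_⟩
    · have := (hk i).2.2
      simp only
      omega
    · simp only [Set.mem_Iic]; omega
  obtain ⟨⟨p, q⟩, h, hn⟩ := this
  simp only at hn
  have hk := key p q h.1 h.2
  obtain ⟨m, rfl⟩ : ∃ m, q = m + 1 := ⟨q - 1, by omega⟩
  refine ⟨m, by omega, fun i => ⟨(p i).toNat, by have := hk i; omega⟩, fun i => ?_⟩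
  have h1 := (hk i).1
  have h2 : (((p i).toNat : ℕ) : ℝ) = (p i : ℝ) := by
    have := Int.toNat_of_nonneg (hk i).2.1
    exact_mod_cast this
  simp only [h2]
  exact h1

theorem upper_haus {d : ℕ} (hd : 0 < d) (w : Fin d → ℝ) (hw : ∀ i, 0 < w i) (τ : ℝ) (hτ : 1 < τ) (j : Fin d)
    (s : ℝ) (hs0 : 0 ≤ s) (hs : sj w τ j < s) : μH[s] (wApprox w 1 τ) = 0 := by
  set SS : ℝ := ∑ i, τ * max (w j - w i) 0 with hSS
  set Q : ℕ → ℝ := fun q => ((q + 1 : ℕ) : ℝ) with hQ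
  have hQ1 : ∀ q, 1 ≤ Q q := fun q => by simp [hQ]
  have hQ0 : ∀ q, 0 < Q q := fun q => by linarith [hQ1 q]
  set M : ℕ → Fin d → ℕ := fun q i => ⌈2 * Q q ^ (τ * max (w j - w i) 0)⌉₊ with hM
  set ρ : ℕ → ℝ := fun q => Q q ^ (-(1 + τ * w j)) with hρ
  have hρpos : ∀ q, 0 < ρ q := fun q => Real.rpow_pos_of_pos (hQ0 q) _
  have hwj := hw j
  have he : 0 < 1 + τ * w j := by positivity
  set A : ℕ → Fin d → ℕ → ℕ → ℝ := fun q i p m => p / Q q - Q q ^ (-(1 + τ * w i)) + m * ρ q with hA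
  refine haus_zero (wApprox w 1 τ) (fun q => (Fin d → Fin (q + 2)) × (∀ i, Fin (M q i)))
    (fun q k => Set.Icc (fun i => A q i (k.1 i) (k.2 i)) (fun i => A q i (k.1 i) (k.2 i) + ρ q)) ρ s hs0
    (fun q => (hρpos q).le) ?_ ?_ ?_ ?_ ?_
  · intro a b hab
    refine Real.rpow_le_rpow_of_nonpos (hQ0 a) ?_ (by linarith)
    simp only [hQ]
    exact_mod_cast Nat.succ_le_succ hab
  · have h1 := (tendsto_rpow_neg_atTop he).comp tendsto_natCast_atTop_atTop
    exact h1.comp (tendsto_add_atTop_nat 1)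
  · intro q k
    refine Metric.ediam_le fun x hx y hy => ?_
    rw [edist_dist]
    refine ENNReal.ofReal_le_ofReal ?_
    rw [dist_pi_le_iff (hρpos q).le]
    intro i
    have a1 := hx.1 i
    have a2 := hx.2 i
    have a3 := hy.1 i
    have a4 := hy.2 i
    simp only at a1 a2 a3 a4
    rw [Real.dist_eq, abs_le]
    constructor <;> linarith
  · intro x hx n
    obtain ⟨q, hq, p, hp⟩ := inf_q hd w hw τ hτ x hx n
    refine ⟨q, hq, ?_⟩
    have hq0 := hQ0 q
    have hx2 : ∀ i, |x i - (p i : ℕ) / Q q| < Q q ^ (-(1 + τ * w i)) := by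
      intro i
      have h1 : |Q q * x i - ((p i : ℕ) : ℝ)| < Q q ^ (-(τ * w i)) := hp i
      have h2 : Q q * x i - ((p i : ℕ) : ℝ) = Q q * (x i - (p i : ℕ) / Q q) := by field_simp
      rw [h2, abs_mul, abs_of_pos hq0] at h1
      have h3 : Q q ^ (-(τ * w i)) = Q q * Q q ^ (-(1 + τ * w i)) := by
        rw [← Real.rpow_one_add' hq0.le (by have := hw i; nlinarith)]
        congr 1; ring
      rw [h3] at h1
      exact lt_of_mul_lt_mul_left h1 hq0.le
    set u : Fin d → ℝ := fun i => (x i - (p i : ℕ) / Q q + Q q ^ (-(1 + τ * w i))) / ρ q with hu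
    have hu0 : ∀ i, 0 ≤ u i := fun i => by
      have := abs_lt.1 (hx2 i)
      exact div_nonneg (by linarith) (hρpos q).le
    have hu1 : ∀ i, u i < M q i := fun i => by
      refine lt_of_lt_of_le ?_ (Nat.le_ceil _)
      rw [hu]
      simp only
      rw [div_lt_iff₀ (hρpos q)]
      have h1 := (abs_lt.1 (hx2 i)).2
      have h2 : Q q ^ (-(1 + τ * w i)) ≤ Q q ^ (τ * max (w j - w i) 0) * ρ q := by
        rw [hρ]
        simp only
        rw [← Real.rpow_add hq0]
        refine Real.rpow_le_rpow_of_exponent_le (hQ1 q) ?_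
        have := le_max_left (w j - w i) 0
        nlinarith
      nlinarith
    refine ⟨(p, fun i => ⟨⌊u i⌋₊, (Nat.floor_lt (hu0 i)).2 (hu1 i)⟩), ?_⟩
    have hxu : ∀ i, x i = (p i : ℕ) / Q q - Q q ^ (-(1 + τ * w i)) + u i * ρ q := by
      intro i
      rw [hu]
      simp only
      rw [div_mul_cancel₀ _ (hρpos q).ne']
      ring
    constructor
    · intro i
      have := Nat.floor_le (hu0 i)
      have h2 := mul_le_mul_of_nonneg_right this (hρpos q).le
      simp only [hA]
      rw [hxu i]
      linarith
    · intro i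
      have := (Nat.lt_floor_add_one (u i)).le
      have h2 := mul_le_mul_of_nonneg_right this (hρpos q).le
      simp only [hA]
      rw [hxu i]
      linarith
  · have hbase : Summable fun q : ℕ => (6 : ℝ) ^ d * Q q ^ ((d : ℝ) + SS - (1 + τ * w j) * s) := by
      refine Summable.mul_left _ ?_
      have h1 : Summable fun q : ℕ => (q : ℝ) ^ ((d : ℝ) + SS - (1 + τ * w j) * s) := by
        rw [Real.summable_nat_rpow]
        unfold sj at hs
        rw [div_lt_iff₀ he, Finset.mul_sum] at hs
        linarith
      exact (summable_nat_add_iff 1).2 h1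
    refine Summable.of_nonneg_of_le (fun q => ?_) (fun q => ?_) hbase
    · have := hρpos q
      positivity
    · have hq1 := hQ1 q
      have hq0 := hQ0 q
      have hc : (Fintype.card ((Fin d → Fin (q + 2)) × (∀ i, Fin (M q i))) : ℝ) = ((q : ℝ) + 2) ^ d * ∏ i, (M q i : ℝ) := by
        simp
      rw [hc]
      have hMle : ∀ i, (M q i : ℝ) ≤ 3 * Q q ^ (τ * max (w j - w i) 0) := by
        intro i
        have h1 : 1 ≤ Q q ^ (τ * max (w j - w i) 0) := Real.one_le_rpow hq1 (by positivity)
        have h2 := (Nat.ceil_lt_add_one (by positivity : 0 ≤ 2 * Q q ^ (τ * max (w j - w i) 0))).le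
        simp only [hM]
        linarith
      have hprod : ∏ i, (M q i : ℝ) ≤ 3 ^ d * Q q ^ SS := by
        calc ∏ i, (M q i : ℝ) ≤ ∏ i, (3 * Q q ^ (τ * max (w j - w i) 0)) :=
              Finset.prod_le_prod (fun i _ => by positivity) fun i _ => hMle i
          _ = _ := by
              rw [Finset.prod_mul_distrib, Finset.prod_const, Finset.card_univ, Fintype.card_fin, hSS,
                Real.rpow_sum_of_pos hq0]
      have hqq : ((q : ℝ) + 2) ^ d ≤ 2 ^ d * Q q ^ (d : ℝ) := by
        rw [Real.rpow_natCast, ← mul_pow]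
        refine pow_le_pow_left₀ (by positivity) ?_ _
        simp only [hQ]; push_cast; linarith [(Nat.cast_nonneg q : (0 : ℝ) ≤ q)]
      have hρs : ρ q ^ s = Q q ^ (-((1 + τ * w j) * s)) := by
        simp only [hρ]
        rw [← Real.rpow_mul hq0.le, neg_mul]
      calc (((q : ℝ) + 2) ^ d * ∏ i, (M q i : ℝ)) * ρ q ^ s ≤ (2 ^ d * Q q ^ (d : ℝ)) * (3 ^ d * Q q ^ SS) * ρ q ^ s := by
            have := hρpos q
            gcongr
        _ = _ := by
            rw [hρs, sub_eq_add_neg, Real.rpow_add hq0, Real.rpow_add hq0, show (6 : ℝ) = 2 * 3 by norm_num, mul_pow]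
            ring

theorem sj_pos {d : ℕ} (w : Fin d → ℝ) (hw : ∀ i, 0 < w i) (τ : ℝ) (hτ : 1 < τ) (j : Fin d) : 0 < sj w τ j := by
  unfold sj
  have := hw j
  have h : 0 ≤ ∑ i, max (w j - w i) 0 := Finset.sum_nonneg fun i _ => le_max_right _ _
  positivity

theorem upper_main {d : ℕ} (hd : 0 < d) (w : Fin d → ℝ) (hw : ∀ i, 0 < w i) (τ : ℝ) (hτ : 1 < τ) (j : Fin d) :
    dimH (wApprox w 1 τ) ≤ ENNReal.ofReal (sj w τ j) := by
  refine dimH_le fun t ht => ?_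
  by_contra hcon
  push Not at hcon
  have h1 : sj w τ j < t := by
    rw [← ENNReal.ofReal_coe_nnreal] at hcon
    exact (ENNReal.ofReal_lt_ofReal_iff_of_nonneg (sj_pos w hw τ hτ j).le).1 hcon
  rw [upper_haus hd w hw τ hτ j t t.2 h1] at ht
  exact ENNReal.zero_ne_top ht

theorem dimH_exact_eq_dimH_approx (d : ℕ) (hd : 1 ≤ d) (w : Fin d → ℝ)
    (hw0 : ∀ i, 0 < w i) (hw1 : ∀ i, w i < 1) (hwmono : Monotone w)
    (hwsum : ∑ i, w i = 1) (τ : ℝ) (hτ : 1 < τ) :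
    dimH (wExact w τ) = dimH (wApprox w 1 τ) := by
  refine le_antisymm (dimH_mono Set.sdiff_subset) ?_
  have : Nonempty (Fin d) := ⟨⟨0, hd⟩⟩
  obtain ⟨j, hj⟩ := Finite.exists_min (fun j => sj w τ j)
  refine (upper_main hd w hw0 τ hτ j).trans ?_
  refine le_of_forall_lt fun c hc => ?_
  obtain ⟨r, hr0, hr1, hr2⟩ := ENNReal.lt_iff_exists_real_btwn.1 hc
  have hlt : r < sj w τ j := by
    rw [ENNReal.ofReal_lt_ofReal_iff (sj_pos w hw0 τ hτ j)] at hr2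
    exact hr2
  have hrpos : 0 < r := by
    have := (zero_le).trans_lt hr1
    exact ENNReal.ofReal_pos.1 this
  exact hr1.trans_le (lower_main hd w hw0 hwsum τ hτ r hrpos fun i => hlt.trans_le (hj i))
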